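/- Let k > 1 and let M ⊆ ℂ^{3k-1} be a 2k-dimensional smooth compact connected submanifold that is totally real except on a finite set S of generic CR-singularities. Then there exist an open neighborhood U of M in ℂ^{3k-1} and a smooth nonnegative function ρ : U → ℝ such that M = ρ^{-1}(0), ρ is plurisubharmonic on U, and ρ is strictly plurisubharmonic on U \ S. -/

import Mathlib

open scoped Manifold ComplexConjugate

noncomputable section

/-- Evaluation of a holomorphic polynomial on `ℂ^n`. -/
def evalPoly {n : ℕ} (P : MvPolynomial (Fin n) ℂ) (z : EuclideanSpace ℂ (Fin n)) : ℂ :=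
  MvPolynomial.eval (fun i => z i) P

/-- The polynomially convex hull of a set `K ⊆ ℂ^n`. -/
def polyHull {n : ℕ} (K : Set (EuclideanSpace ℂ (Fin n))) : Set (EuclideanSpace ℂ (Fin n)) :=
  {z | ∀ P : MvPolynomial (Fin n) ℂ, ‖evalPoly P z‖ ≤ ⨆ w ∈ K, ‖evalPoly P w‖}

/-- A set is polynomially convex if it coincides with its polynomially convex hull. -/
def IsPolyConvex {n : ℕ} (K : Set (EuclideanSpace ℂ (Fin n))) : Prop := polyHull K = K

/-- The rationally convex hull of a set `K ⊆ ℂ^n`. -/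
def ratHull {n : ℕ} (K : Set (EuclideanSpace ℂ (Fin n))) : Set (EuclideanSpace ℂ (Fin n)) :=
  {z | ∀ P : MvPolynomial (Fin n) ℂ, evalPoly P z = 0 → ∃ w ∈ K, evalPoly P w = 0}

/-- The closed half-space `{x ∈ ℝ^d : x₀ ≥ 0}`. -/
def halfSpace (d : ℕ) (hd : 0 < d) : Set (EuclideanSpace ℝ (Fin d)) :=
  {x | 0 ≤ x ⟨0, hd⟩}

/-- `M ⊆ ℂ^n` is a `d`-dimensional smooth compact submanifold (possibly with boundary):
every point admits a smooth local parametrization by a relatively open subset of the closed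
half-space `H ⊆ ℝ^d`, which is an immersion and a homeomorphism onto a relatively open
subset of `M`. (Charts with image in the open half-space cover interior points, so closed
submanifolds are included.) -/
def IsSubmanifold {n : ℕ} (d : ℕ) (hd : 0 < d) (M : Set (EuclideanSpace ℂ (Fin n))) : Prop :=
  ∀ p ∈ M, ∃ (V : Set (EuclideanSpace ℝ (Fin d))) (U : Set (EuclideanSpace ℂ (Fin n)))
    (f : EuclideanSpace ℝ (Fin d) → EuclideanSpace ℂ (Fin n)),
    IsOpen V ∧ IsOpen U ∧ p ∈ U ∧ ContDiffOn ℝ (⊤ : ℕ∞) f V ∧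
    Set.InjOn f (V ∩ halfSpace d hd) ∧
    (∀ x ∈ V, Function.Injective (fderiv ℝ f x)) ∧
    f '' (V ∩ halfSpace d hd) = M ∩ U ∧
    (∀ W, IsOpen W → W ⊆ V → ∃ U', IsOpen U' ∧ f '' (W ∩ halfSpace d hd) = M ∩ U')

/-- `p` is a boundary point of the submanifold `M`: some local parametrization as above
maps a point on the boundary of the half-space to `p`. -/
def IsBoundaryPoint {n : ℕ} (d : ℕ) (hd : 0 < d) (M : Set (EuclideanSpace ℂ (Fin n)))
    (p : EuclideanSpace ℂ (Fin n)) : Prop :=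
  p ∈ M ∧ ∃ (V : Set (EuclideanSpace ℝ (Fin d))) (U : Set (EuclideanSpace ℂ (Fin n)))
    (f : EuclideanSpace ℝ (Fin d) → EuclideanSpace ℂ (Fin n)),
    IsOpen V ∧ IsOpen U ∧ p ∈ U ∧ ContDiffOn ℝ (⊤ : ℕ∞) f V ∧
    Set.InjOn f (V ∩ halfSpace d hd) ∧
    (∀ x ∈ V, Function.Injective (fderiv ℝ f x)) ∧
    f '' (V ∩ halfSpace d hd) = M ∩ U ∧
    (∀ W, IsOpen W → W ⊆ V → ∃ U', IsOpen U' ∧ f '' (W ∩ halfSpace d hd) = M ∩ U') ∧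
    ∃ x ∈ V ∩ halfSpace d hd, f x = p ∧ x ⟨0, hd⟩ = 0

/-- The tangent space of `M ⊆ ℂ^n` at `p`, as a real subspace of `ℂ^n`. -/
def tangentSpaceAt {n : ℕ} (M : Set (EuclideanSpace ℂ (Fin n)))
    (p : EuclideanSpace ℂ (Fin n)) : Submodule ℝ (EuclideanSpace ℂ (Fin n)) :=
  Submodule.span ℝ (tangentConeAt ℝ M p)

/-- `M` is totally real at `p`: `T_pM ∩ i·T_pM = {0}`. -/
def TotallyRealAt {n : ℕ} (M : Set (EuclideanSpace ℂ (Fin n)))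
    (p : EuclideanSpace ℂ (Fin n)) : Prop :=
  ∀ v ∈ tangentSpaceAt M p, Complex.I • v ∈ tangentSpaceAt M p → v = (0 : EuclideanSpace ℂ (Fin n))

/-- The Beloshapka–Coffman normal form `𝓜_k ⊆ ℂ^{3k-1}`, in coordinates
`Z = (z, w₁, …, w_{2k-2}, ζ₁, …, ζ_k)`, `w_τ = u_τ + i v_τ`. -/
def bcForm (k : ℕ) (hk : 1 < k) : Set (EuclideanSpace ℂ (Fin (3*k-1))) :=
  {Z | (∀ τ : ℕ, ∀ _h1 : 1 ≤ τ, ∀ _h2 : τ ≤ 2*k-2, (Z ⟨τ, by omega⟩).im = 0) ∧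
    Z ⟨2*k-1, by omega⟩ = (Complex.normSq (Z ⟨0, by omega⟩) : ℂ) +
      conj (Z ⟨0, by omega⟩) * (((Z ⟨1, by omega⟩).re : ℂ) + Complex.I * ((Z ⟨2, by omega⟩).re : ℂ)) ∧
    (∀ σ : ℕ, ∀ _h1 : 2 ≤ σ, ∀ _h2 : σ ≤ k-1,
      Z ⟨2*k-2+σ, by omega⟩ = conj (Z ⟨0, by omega⟩) *
        (((Z ⟨2*σ-1, by omega⟩).re : ℂ) + Complex.I * ((Z ⟨2*σ, by omega⟩).re : ℂ))) ∧
    Z ⟨3*k-2, by omega⟩ = (conj (Z ⟨0, by omega⟩))^2}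

/-- `p` is a generic CR-singularity of `M ⊆ ℂ^{3k-1}`: `(M, p)` is locally biholomorphic
to `(𝓜_k, O)`. -/
def IsGenericCRSingularity (k : ℕ) (hk : 1 < k) (M : Set (EuclideanSpace ℂ (Fin (3*k-1))))
    (p : EuclideanSpace ℂ (Fin (3*k-1))) : Prop :=
  ∃ (U V : Set (EuclideanSpace ℂ (Fin (3*k-1))))
    (Φ Ψ : EuclideanSpace ℂ (Fin (3*k-1)) → EuclideanSpace ℂ (Fin (3*k-1))),
    IsOpen U ∧ IsOpen V ∧ p ∈ U ∧ (0 : EuclideanSpace ℂ (Fin (3*k-1))) ∈ V ∧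
    DifferentiableOn ℂ Φ U ∧ DifferentiableOn ℂ Ψ V ∧
    Set.MapsTo Φ U V ∧ Set.MapsTo Ψ V U ∧
    (∀ x ∈ U, Ψ (Φ x) = x) ∧ (∀ y ∈ V, Φ (Ψ y) = y) ∧
    Φ p = 0 ∧ Φ '' (M ∩ U) = bcForm k hk ∩ V

/-- The Laplacian at `0` of the slice function `λ ↦ ρ(p + λ·v)`. -/
def sliceLaplacian {n : ℕ} (ρ : EuclideanSpace ℂ (Fin n) → ℝ)
    (p v : EuclideanSpace ℂ (Fin n)) : ℝ :=
  iteratedFDeriv ℝ 2 (fun lam : ℂ => ρ (p + lam • v)) 0 ![1, 1]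
  + iteratedFDeriv ℝ 2 (fun lam : ℂ => ρ (p + lam • v)) 0 ![Complex.I, Complex.I]

/-- `ρ` is plurisubharmonic on `U`. -/
def PshOn {n : ℕ} (ρ : EuclideanSpace ℂ (Fin n) → ℝ) (U : Set (EuclideanSpace ℂ (Fin n))) : Prop :=
  ∀ p ∈ U, ∀ v : EuclideanSpace ℂ (Fin n), 0 ≤ sliceLaplacian ρ p v

/-- `ρ` is strictly plurisubharmonic at `p`. -/
def StrictPshAt {n : ℕ} (ρ : EuclideanSpace ℂ (Fin n) → ℝ)
    (p : EuclideanSpace ℂ (Fin n)) : Prop :=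
  ∀ v : EuclideanSpace ℂ (Fin n), v ≠ 0 → 0 < sliceLaplacian ρ p v

/-- `ρ` is strictly plurisubharmonic on a set. -/
def StrictPshOn {n : ℕ} (ρ : EuclideanSpace ℂ (Fin n) → ℝ)
    (U : Set (EuclideanSpace ℂ (Fin n))) : Prop :=
  ∀ p ∈ U, StrictPshAt ρ p

section SeveralVariables

open Metric Set Filter Topology MeasureTheory

variable {E F : Type*} [NormedAddCommGroup E] [NormedSpace ℂ E] [FiniteDimensional ℂ E]
  [NormedAddCommGroup F] [NormedSpace ℂ F] [FiniteDimensional ℂ F]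

/-- Directional derivatives of a holomorphic map of several variables are holomorphic. -/
theorem differentiableOn_fderiv_apply {f : E → F} {U : Set E}
    (hf : DifferentiableOn ℂ f U) (hU : IsOpen U) (e : E) :
    DifferentiableOn ℂ (fun x => fderiv ℂ f x e) U := by
  intro x₀ hx₀
  refine DifferentiableAt.differentiableWithinAt ?_
  have : CompleteSpace F := FiniteDimensional.complete ℂ F
  have : CompleteSpace E := FiniteDimensional.complete ℂ E
  have : ProperSpace E := FiniteDimensional.proper ℂ E
  have : ProperSpace (E →L[ℂ] F) := FiniteDimensional.proper ℂ (E →L[ℂ] F)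
  borelize E
  have hc : ContinuousAt f x₀ := (hf.differentiableAt (hU.mem_nhds hx₀)).continuousAt
  obtain ⟨R, hR, hRU, hRf⟩ : ∃ R > 0, ball x₀ R ⊆ U ∧ ∀ x ∈ ball x₀ R, dist (f x) (f x₀) < 1 := by
    have h1 : ∀ᶠ x in 𝓝 x₀, x ∈ U ∧ dist (f x) (f x₀) < 1 :=
      (hU.eventually_mem hx₀).and (hc.eventually (ball_mem_nhds _ one_pos))
    obtain ⟨R, hR, h⟩ := Metric.eventually_nhds_iff_ball.1 h1
    exact ⟨R, hR, fun x hx => (h x hx).1, fun x hx => (h x hx).2⟩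
  have hbound : ∀ y ∈ ball x₀ (R / 2), ‖fderiv ℂ f y‖ ≤ 2 / (R / 2) := by
    intro y hy
    have hsub : ball y (R / 2) ⊆ ball x₀ R := by
      apply ball_subset_ball'
      rw [mem_ball] at hy
      linarith
    refine Complex.norm_fderiv_le_div_of_mapsTo_ball (hf.mono (hsub.trans hRU)) ?_ (by positivity)
    intro x hx
    have h1 := hRf x (hsub hx)
    have h2 := hRf y (hsub (mem_ball_self (by positivity)))
    have h3 := dist_triangle_right (f x) (f y) (f x₀)
    simp only [mem_closedBall]
    linarith
  obtain ⟨r, hr, hre⟩ : ∃ r > 0, r * ‖e‖ < R / 4 := by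
    refine ⟨R / (8 * (‖e‖ + 1)), by positivity, ?_⟩
    rw [div_mul_eq_mul_div, div_lt_iff₀ (by positivity)]
    nlinarith [norm_nonneg e]
  have hmem : ∀ x ∈ ball x₀ (R / 4), ∀ w : ℂ, ‖w‖ ≤ r → x + w • e ∈ ball x₀ (R / 2) := by
    intro x hx w hw
    rw [mem_ball, dist_eq_norm] at hx ⊢
    calc ‖x + w • e - x₀‖ = ‖(x - x₀) + w • e‖ := by congr 1; abel
      _ ≤ ‖x - x₀‖ + ‖w‖ * ‖e‖ := (norm_add_le _ _).trans (by rw [norm_smul])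
      _ < R / 4 + R / 4 := by
        have := mul_le_mul_of_nonneg_right hw (norm_nonneg e)
        linarith
      _ = R / 2 := by ring
  have hhalf : ball x₀ (R / 2) ⊆ U := (ball_subset_ball (by linarith)).trans hRU
  have hdiff : ∀ y ∈ ball x₀ (R / 2), HasFDerivAt f (fderiv ℂ f y) y := fun y hy =>
    (hf.differentiableAt (hU.mem_nhds (hhalf hy))).hasFDerivAt
  have hcm : ∀ θ : ℝ, ‖circleMap 0 r θ‖ ≤ r := fun θ => by
    simp [circleMap, abs_of_pos hr]
  have hcauchy : ∀ x ∈ ball x₀ (R / 4),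
      (2 * Real.pi * Complex.I : ℂ)⁻¹ • ∮ w in C(0, r), ((w - 0) ^ 2)⁻¹ • f (x + w • e) =
        fderiv ℂ f x e := by
    intro x hx
    have hV : IsOpen ((fun w : ℂ => x + w • e) ⁻¹' ball x₀ (R / 2)) :=
      isOpen_ball.preimage (by fun_prop)
    have hg : DifferentiableOn ℂ (fun w : ℂ => f (x + w • e))
        ((fun w : ℂ => x + w • e) ⁻¹' ball x₀ (R / 2)) := by
      refine (hf.mono hhalf).comp (t := ball x₀ (R / 2)) ?_ (mapsTo_preimage _ _)
      fun_prop
    have := Complex.cderiv_eq_deriv hV hg hr (z := 0) (by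
      intro w hw
      exact hmem x hx w (by simpa using hw))
    rw [Complex.cderiv] at this
    rw [this]
    have hx2 : x ∈ ball x₀ (R / 2) := ball_subset_ball (by linarith) hx
    have h1 : HasDerivAt (fun w : ℂ => x + w • e) e 0 := by
      simpa using ((hasDerivAt_id (0 : ℂ)).smul_const e).const_add x
    have h2 : HasFDerivAt f (fderiv ℂ f x) ((fun w : ℂ => x + w • e) 0) := by
      simpa using hdiff x hx2
    exact (h2.comp_hasDerivAt 0 h1).deriv
  set K : ℝ → ℂ := fun θ => deriv (circleMap 0 r) θ * ((circleMap 0 r θ) ^ 2)⁻¹ with hK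
  have hKc : Continuous K := by
    have h0 : ∀ θ, (circleMap 0 r θ) ^ 2 ≠ 0 := fun θ =>
      pow_ne_zero _ (circleMap_ne_center hr.ne')
    simp only [hK, deriv_circleMap]
    exact (by fun_prop : Continuous fun θ => circleMap 0 r θ * Complex.I).mul
      (Continuous.inv₀ (by fun_prop) h0)
  have hint : HasFDerivAt (fun x => ∫ θ in (0 : ℝ)..2 * Real.pi, K θ • f (x + circleMap 0 r θ • e))
      (∫ θ in (0 : ℝ)..2 * Real.pi, K θ • fderiv ℂ f (x₀ + circleMap 0 r θ • e)) x₀ := by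
    have hcont : ∀ x ∈ ball x₀ (R / 4),
        Continuous fun θ : ℝ => K θ • f (x + circleMap 0 r θ • e) := by
      intro x hx
      refine hKc.smul (continuous_iff_continuousAt.2 fun θ => ?_)
      exact ContinuousAt.comp (f := fun θ : ℝ => x + circleMap 0 r θ • e) (g := f)
        (hdiff _ (hmem x hx _ (hcm θ))).continuousAt
        (by fun_prop)
    refine intervalIntegral.hasFDerivAt_integral_of_dominated_of_fderiv_le
      (bound := fun θ => ‖K θ‖ * (2 / (R / 2)))
      (F' := fun x θ => K θ • fderiv ℂ f (x + circleMap 0 r θ • e))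
      (ball_mem_nhds x₀ (show 0 < R / 4 by positivity)) ?_ ?_ ?_ ?_ ?_ ?_
    · filter_upwards [ball_mem_nhds x₀ (show 0 < R / 4 by positivity)] with x hx
      exact (hcont x hx).aestronglyMeasurable
    · exact (hcont x₀ (mem_ball_self (by positivity))).intervalIntegrable _ _
    · refine (Measurable.aestronglyMeasurable ?_)
      refine hKc.measurable.smul ((measurable_fderiv ℂ f).comp ?_)
      exact Continuous.measurable (by fun_prop)
    · refine Eventually.of_forall fun θ _ x hx => ?_
      rw [norm_smul]
      gcongr
      exact hbound _ (hmem x hx _ (hcm θ))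
    · exact (Continuous.intervalIntegrable (by fun_prop) _ _)
    · refine Eventually.of_forall fun θ _ x hx => ?_
      refine HasFDerivAt.const_smul ?_ (K θ)
      exact (hasFDerivAt_comp_add_right (x := x) (circleMap 0 r θ • e)).2 (hdiff _ (hmem x hx _ (hcm θ)))
  refine ((hint.const_smul ((2 * Real.pi * Complex.I : ℂ)⁻¹)).congr_of_eventuallyEq ?_).differentiableAt
  filter_upwards [ball_mem_nhds x₀ (show 0 < R / 4 by positivity)] with x hx
  rw [← hcauchy x hx]
  simp only [circleIntegral, hK, sub_zero, smul_smul, Pi.smul_apply]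

/-- A holomorphic map of several variables is smooth. -/
theorem contDiffOn_infty_of_differentiableOn {f : E → F} {U : Set E}
    (hf : DifferentiableOn ℂ f U) (hU : IsOpen U) : ContDiffOn ℂ (⊤ : ℕ∞) f U := by
  rw [contDiffOn_infty]
  intro n
  induction n generalizing f with
  | zero => simpa using hf.continuousOn
  | succ n ih =>
    have : ((n + 1 : ℕ) : WithTop ℕ∞) = (n : WithTop ℕ∞) + 1 := by push_cast; rfl
    rw [this, contDiffOn_succ_iff_fderiv_of_isOpen hU]
    refine ⟨hf, fun h => by simp at h, ?_⟩
    rw [contDiffOn_clm_apply]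
    exact fun e => ih (differentiableOn_fderiv_apply hf hU e)

end SeveralVariables
section Jets

open Filter Topology

/-- `g : ℂ → ℂ` is twice real differentiable at `0`, with value `a`, first Wirtinger derivatives
`∂g = b`, `∂̄g = c` and mixed second derivative `∂∂̄g = d` at `0`. -/
structure HasJet (g : ℂ → ℂ) (a b c d : ℂ) : Prop where
  value : g 0 = a
  exists_deriv : ∃ (g' : ℂ → ℂ →L[ℝ] ℂ) (H : ℂ →L[ℝ] ℂ →L[ℝ] ℂ),
    (∀ᶠ x in 𝓝 0, HasFDerivAt g (g' x) x) ∧ HasFDerivAt g' H 0 ∧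
    g' 0 1 = b + c ∧ g' 0 Complex.I = Complex.I * (b - c) ∧
    H 1 1 + H Complex.I Complex.I = 4 * d

variable {g h : ℂ → ℂ} {a b c d a' b' c' d' : ℂ}

theorem HasJet.congr (hg : HasJet g a b c d) (hgh : h =ᶠ[𝓝 0] g) : HasJet h a b c d := by
  obtain ⟨h0, g', H, h1, h2, h3⟩ := hg
  refine ⟨hgh.eq_of_nhds.trans h0, g', H, ?_, h2, h3⟩
  filter_upwards [h1, hgh.eventuallyEq_nhds] with x hx hx' using hx.congr_of_eventuallyEq hx'

theorem HasJet.const (a : ℂ) : HasJet (fun _ => a) a 0 0 0 :=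
  ⟨rfl, fun _ => 0, 0, .of_forall fun x => hasFDerivAt_const a x, hasFDerivAt_const _ _,
    by simp, by simp, by simp⟩

theorem HasJet.add (hg : HasJet g a b c d) (hh : HasJet h a' b' c' d') :
    HasJet (fun x => g x + h x) (a + a') (b + b') (c + c') (d + d') := by
  obtain ⟨rfl, g', H, h1, h2, h3, h4, h5⟩ := hg
  obtain ⟨rfl, k', K, i1, i2, i3, i4, i5⟩ := hh
  refine ⟨rfl, fun x => g' x + k' x, H + K, ?_, h2.add i2, ?_, ?_, ?_⟩
  · filter_upwards [h1, i1] with x hx hx' using hx.add hx'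
  · simp only [add_apply, h3, i3]; ring
  · simp only [add_apply, h4, i4]; ring
  · simp only [add_apply]; linear_combination h5 + i5

theorem HasJet.neg (hg : HasJet g a b c d) : HasJet (fun x => -g x) (-a) (-b) (-c) (-d) := by
  obtain ⟨rfl, g', H, h1, h2, h3, h4, h5⟩ := hg
  refine ⟨rfl, fun x => -g' x, -H, ?_, h2.neg, ?_, ?_, ?_⟩
  · filter_upwards [h1] with x hx using hx.neg
  · simp only [neg_apply, h3]; ring
  · simp only [neg_apply, h4]; ring
  · simp only [neg_apply]; linear_combination -h5

theorem HasJet.sub (hg : HasJet g a b c d) (hh : HasJet h a' b' c' d') :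
    HasJet (fun x => g x - h x) (a - a') (b - b') (c - c') (d - d') := by
  simpa only [sub_eq_add_neg] using hg.add hh.neg

theorem HasJet.mul (hg : HasJet g a b c d) (hh : HasJet h a' b' c' d') :
    HasJet (fun x => g x * h x) (a * a') (a * b' + a' * b) (a * c' + a' * c)
      (a * d' + a' * d + b * c' + c * b') := by
  obtain ⟨rfl, g', H, h1, h2, h3, h4, h5⟩ := hg
  obtain ⟨rfl, k', K, i1, i2, i3, i4, i5⟩ := hh
  refine ⟨rfl, fun x => g x • k' x + h x • g' x, _, ?_,
    (h1.self_of_nhds.smul i2).add (i1.self_of_nhds.smul h2), ?_, ?_, ?_⟩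
  · filter_upwards [h1, i1] with x hx hx' using hx.mul hx'
  · simp only [add_apply, smul_apply, h3, i3, smul_eq_mul]; ring
  · simp only [add_apply, smul_apply, h4, i4, smul_eq_mul]; ring
  · simp only [add_apply, smul_apply, ContinuousLinearMap.smulRight_apply, h3, h4, i3, i4,
      smul_eq_mul]
    linear_combination g 0 * i5 + h 0 * h5 +
      2 * (b - c) * (b' - c') * Complex.I_mul_I

theorem HasJet.conj (hg : HasJet g a b c d) :
    HasJet (fun x => starRingEnd ℂ (g x)) (starRingEnd ℂ a) (starRingEnd ℂ c) (starRingEnd ℂ b)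
      (starRingEnd ℂ d) := by
  obtain ⟨rfl, g', H, h1, h2, h3, h4, h5⟩ := hg
  let C : ℂ →L[ℝ] ℂ := Complex.conjCLE
  refine ⟨rfl, fun x => C.comp (g' x), (ContinuousLinearMap.compL ℝ ℂ ℂ ℂ C).comp H, ?_,
    (ContinuousLinearMap.compL ℝ ℂ ℂ ℂ C).hasFDerivAt.comp (0 : ℂ) h2, ?_, ?_, ?_⟩
  · filter_upwards [h1] with x hx using C.hasFDerivAt.comp x hx
  · simp [C, h3, add_comm]
  · simp only [C, ContinuousLinearMap.comp_apply, h4, ContinuousLinearEquiv.coe_coe,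
      Complex.conjCLE_apply, map_mul, map_sub, Complex.conj_I]
    ring
  · have := congrArg (starRingEnd ℂ) h5
    simpa [C, Complex.conj_ofNat] using this

theorem HasJet.sum {ι : Type*} {s : Finset ι} {g : ι → ℂ → ℂ} {a b c d : ι → ℂ}
    (hg : ∀ i ∈ s, HasJet (g i) (a i) (b i) (c i) (d i)) :
    HasJet (fun x => ∑ i ∈ s, g i x) (∑ i ∈ s, a i) (∑ i ∈ s, b i) (∑ i ∈ s, c i)
      (∑ i ∈ s, d i) := by
  classical
  induction s using Finset.induction_on with
  | empty => simpa using HasJet.const 0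
  | insert i s hi ih =>
    simp only [Finset.sum_insert hi]
    exact (hg i (Finset.mem_insert_self i s)).add
      (ih fun j hj => hg j (Finset.mem_insert_of_mem hj))

theorem HasJet.normSq (hg : HasJet g a b c d) :
    HasJet (fun x => (Complex.normSq (g x) : ℂ)) (Complex.normSq a)
      (a * starRingEnd ℂ c + starRingEnd ℂ a * b) (a * starRingEnd ℂ b + starRingEnd ℂ a * c)
      (Complex.normSq b + Complex.normSq c +
        (a * starRingEnd ℂ d + starRingEnd ℂ a * d)) := by
  have := hg.mul hg.conj
  simp only [Complex.mul_conj] at this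
  convert this using 1
  rw [← Complex.mul_conj, ← Complex.mul_conj]; ring

/-- A holomorphic function of one variable has vanishing `∂̄` and `∂∂̄` derivatives. -/
theorem hasJet_of_differentiableAt (hg : ∀ᶠ x in 𝓝 0, DifferentiableAt ℂ g x) :
    HasJet g (g 0) (deriv g 0) 0 0 := by
  have han : AnalyticAt ℂ g 0 := Complex.analyticAt_iff_eventually_differentiableAt.2 hg
  let T : ℂ →L[ℝ] ℂ →L[ℝ] ℂ := ContinuousLinearMap.mul ℝ ℂ
  have h2 : HasFDerivAt (deriv g)
      ((ContinuousLinearMap.toSpanSingleton ℂ (deriv (deriv g) 0)).restrictScalars ℝ) 0 :=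
    (han.deriv.differentiableAt.hasDerivAt.hasFDerivAt).restrictScalars ℝ
  refine ⟨rfl, fun x => T (deriv g x), _, ?_, T.hasFDerivAt.comp (0 : ℂ) h2, ?_, ?_, ?_⟩
  · filter_upwards [hg] with x hx
    have hT : T (deriv g x) =
        (ContinuousLinearMap.toSpanSingleton ℂ (deriv g x)).restrictScalars ℝ := by
      ext
      simp [T, mul_comm]
    rw [hT]
    exact hx.hasDerivAt.hasFDerivAt.restrictScalars ℝ
  · simp [T]
  · simp [T, mul_comm]
  · simp only [T, ContinuousLinearMap.comp_apply, ContinuousLinearMap.mul_apply',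
      ContinuousLinearMap.coe_restrictScalars', ContinuousLinearMap.toSpanSingleton_apply,
      smul_eq_mul]
    linear_combination deriv (deriv g) 0 * Complex.I_mul_I

/-- A twice continuously differentiable function has a jet, determined by its derivatives. -/
theorem ContDiffAt.exists_hasJet (hg : ContDiffAt ℝ 2 g 0) :
    ∃ b c d, HasJet g (g 0) b c d ∧ fderiv ℝ g 0 1 = b + c ∧
      fderiv ℝ g 0 Complex.I = Complex.I * (b - c) := by
  have h1 : ∀ᶠ x in 𝓝 0, HasFDerivAt g (fderiv ℝ g x) x := by
    filter_upwards [hg.eventually (by simp)] with x hx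
    exact (hx.differentiableAt (by simp)).hasFDerivAt
  have h2 : HasFDerivAt (fderiv ℝ g) (fderiv ℝ (fderiv ℝ g) 0) 0 :=
    ((hg.fderiv_right (m := 1) (by norm_num)).differentiableAt (by simp)).hasFDerivAt
  set p := fderiv ℝ g 0 1
  set q := fderiv ℝ g 0 Complex.I
  have e1 : p = (p - Complex.I * q) / 2 + (p + Complex.I * q) / 2 := by ring
  have e2 : q = Complex.I * ((p - Complex.I * q) / 2 - (p + Complex.I * q) / 2) := by
    linear_combination q * Complex.I_mul_I
  exact ⟨(p - Complex.I * q) / 2, (p + Complex.I * q) / 2,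
    (fderiv ℝ (fderiv ℝ g) 0 1 1 + fderiv ℝ (fderiv ℝ g) 0 Complex.I Complex.I) / 4,
    ⟨rfl, _, _, h1, h2, e1, e2, by ring⟩, e1, e2⟩

variable {n : ℕ} {ρ : EuclideanSpace ℂ (Fin n) → ℝ} {p v : EuclideanSpace ℂ (Fin n)}

theorem HasJet.sliceLaplacian_eq (hρ : HasJet (fun t : ℂ => (ρ (p + t • v) : ℂ)) a b c d) :
    sliceLaplacian ρ p v = 4 * d.re := by
  obtain ⟨-, g', H, h1, h2, -, -, h5⟩ := hρ
  have k1 : fderiv ℝ (fun t : ℂ => ρ (p + t • v)) =ᶠ[𝓝 0] fun x => Complex.reCLM.comp (g' x) := by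
    filter_upwards [h1] with x hx
    exact (Complex.reCLM.hasFDerivAt.comp x hx).fderiv
  have k2 : HasFDerivAt (fderiv ℝ (fun t : ℂ => ρ (p + t • v)))
      ((ContinuousLinearMap.compL ℝ ℂ ℂ ℝ Complex.reCLM).comp H) 0 :=
    ((ContinuousLinearMap.compL ℝ ℂ ℂ ℝ Complex.reCLM).hasFDerivAt.comp (0 : ℂ)
      h2).congr_of_eventuallyEq k1
  have := congrArg Complex.re h5
  simp only [sliceLaplacian, iteratedFDeriv_two_apply, k2.fderiv]
  simpa using this

/-- A `C²` function has a jet along each complex line, whose mixed second derivative is the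
slice Laplacian. -/
theorem ContDiffAt.exists_hasJet_slice (hρ : ContDiffAt ℝ 2 ρ p) (v : EuclideanSpace ℂ (Fin n)) :
    ∃ b c d, HasJet (fun t : ℂ => (ρ (p + t • v) : ℂ)) (ρ p) b c d ∧
      sliceLaplacian ρ p v = 4 * d.re ∧ (fderiv ℝ ρ p = 0 → b = 0 ∧ c = 0) := by
  have hl : ContDiffAt ℝ 2 (fun t : ℂ => p + t • v) 0 := by fun_prop
  have hs : ContDiffAt ℝ 2 (fun t : ℂ => (ρ (p + t • v) : ℂ)) 0 := by
    refine Complex.ofRealCLM.contDiff.contDiffAt.comp (0 : ℂ) ?_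
    refine ContDiffAt.comp (0 : ℂ) ?_ hl
    simpa using hρ
  obtain ⟨b, c, d, hj, h1, h2⟩ := hs.exists_hasJet
  refine ⟨b, c, d, by simpa using hj, hj.sliceLaplacian_eq, fun h0 => ?_⟩
  have hz : fderiv ℝ (fun t : ℂ => (ρ (p + t • v) : ℂ)) 0 = 0 := by
    have hρ' : HasFDerivAt ρ (0 : EuclideanSpace ℂ (Fin n) →L[ℝ] ℝ) (p + (0 : ℂ) • v) := by
      simpa [h0] using (hρ.differentiableAt (by simp)).hasFDerivAt
    have := Complex.ofRealCLM.hasFDerivAt.comp (0 : ℂ)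
      (hρ'.comp (0 : ℂ) (hl.differentiableAt (by simp)).hasFDerivAt)
    rw [ContinuousLinearMap.zero_comp, ContinuousLinearMap.comp_zero] at this
    exact this.fderiv
  rw [hz] at h1 h2
  have h3 : b - c = 0 := by simpa using h2.symm
  have h4 : b + c = 0 := by simpa using h1.symm
  exact ⟨by linear_combination (h3 + h4) / 2, by linear_combination (h4 - h3) / 2⟩

end Jets
section TotallyReal

open Filter Topology Set

variable {n : ℕ}

theorem two_le_infty : (2 : WithTop ℕ∞) ≤ ((⊤ : ℕ∞) : WithTop ℕ∞) :=
  WithTop.coe_le_coe.2 (le_top : (2 : ℕ∞) ≤ ⊤)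

theorem fderiv_fderiv_comp_affine {E F : Type*} [NormedAddCommGroup E] [NormedSpace ℝ E]
    [NormedAddCommGroup F] [NormedSpace ℝ F] {ρ : E → ℝ} {p : E} (hρ : ContDiffAt ℝ 2 ρ p)
    (l : F →L[ℝ] E) (s t : F) :
    fderiv ℝ (fderiv ℝ fun x => ρ (p + l x)) 0 s t = fderiv ℝ (fderiv ℝ ρ) p (l s) (l t) := by
  have hl : ∀ x, HasFDerivAt (fun x => p + l x) l x := fun x => l.hasFDerivAt.const_add p
  have hp : p + l 0 = p := by simp
  let C : (E →L[ℝ] ℝ) →L[ℝ] (F →L[ℝ] ℝ) := (ContinuousLinearMap.compL ℝ F E ℝ).flip l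
  have h1 : (fderiv ℝ fun x => ρ (p + l x)) =ᶠ[𝓝 0] fun x => C (fderiv ℝ ρ (p + l x)) := by
    have hc : Tendsto (fun x => p + l x) (𝓝 0) (𝓝 p) := by
      simpa using (hl 0).continuousAt.tendsto
    filter_upwards [hc.eventually (hρ.eventually (by simp))] with x hx
    exact ((hx.differentiableAt (by simp)).hasFDerivAt.comp x (hl x)).fderiv
  have h2 : HasFDerivAt (fderiv ℝ ρ) (fderiv ℝ (fderiv ℝ ρ) p) (p + l 0) := by
    rw [hp]
    exact ((hρ.fderiv_right (m := 1) (by norm_num)).differentiableAt (by simp)).hasFDerivAt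
  have h3 := ((C.hasFDerivAt.comp (0 : F) (h2.comp (0 : F) (hl 0))).congr_of_eventuallyEq h1).fderiv
  rw [h3]
  rfl

theorem sliceLaplacian_eq_fderiv_fderiv {ρ : EuclideanSpace ℂ (Fin n) → ℝ}
    {p : EuclideanSpace ℂ (Fin n)} (hρ : ContDiffAt ℝ 2 ρ p) (v : EuclideanSpace ℂ (Fin n)) :
    sliceLaplacian ρ p v = fderiv ℝ (fderiv ℝ ρ) p v v +
      fderiv ℝ (fderiv ℝ ρ) p (Complex.I • v) (Complex.I • v) := by
  have h := fderiv_fderiv_comp_affine hρ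
    ((ContinuousLinearMap.toSpanSingleton ℂ v).restrictScalars ℝ)
  simp only [ContinuousLinearMap.coe_restrictScalars',
    ContinuousLinearMap.toSpanSingleton_apply] at h
  simp only [sliceLaplacian, iteratedFDeriv_two_apply, Matrix.cons_val_zero, Matrix.cons_val_one, h,
    one_smul]

/-- Strict plurisubharmonicity is an open condition. -/
theorem StrictPshAt.eventually {ρ : EuclideanSpace ℂ (Fin n) → ℝ}
    {p : EuclideanSpace ℂ (Fin n)} (h : StrictPshAt ρ p) (hρ : ContDiffAt ℝ 2 ρ p) :
    ∀ᶠ q in 𝓝 p, StrictPshAt ρ q := by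
  have hD : ContinuousAt (fderiv ℝ (fderiv ℝ ρ)) p :=
    ((hρ.fderiv_right (m := 1) (by norm_num)).fderiv_right (m := 0) (by norm_num)).continuousAt
  have hcomp : IsCompact (Metric.sphere (0 : EuclideanSpace ℂ (Fin n)) 1) := isCompact_sphere _ _
  have hev : ∀ᶠ q in 𝓝 p, ∀ v ∈ Metric.sphere (0 : EuclideanSpace ℂ (Fin n)) 1,
      0 < fderiv ℝ (fderiv ℝ ρ) q v v +
        fderiv ℝ (fderiv ℝ ρ) q (Complex.I • v) (Complex.I • v) := by
    refine hcomp.eventually_forall_of_forall_eventually fun v hv => ?_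
    have hv0 : v ≠ 0 := by
      rintro rfl
      simp at hv
    have hpos := h v hv0
    rw [sliceLaplacian_eq_fderiv_fderiv hρ] at hpos
    have h1 : ContinuousAt (fun z : EuclideanSpace ℂ (Fin n) × EuclideanSpace ℂ (Fin n) =>
        fderiv ℝ (fderiv ℝ ρ) z.1) (p, v) := hD.comp (x := (p, v)) continuousAt_fst
    have h2 : ContinuousAt (fun z : EuclideanSpace ℂ (Fin n) × EuclideanSpace ℂ (Fin n) =>
        Complex.I • z.2) (p, v) := by fun_prop
    exact (((h1.clm_apply continuousAt_snd).clm_apply continuousAt_snd).add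
      ((h1.clm_apply h2).clm_apply h2)).eventually (lt_mem_nhds hpos)
  filter_upwards [hev, hρ.eventually (by simp)] with q hq hq2 v hv
  rw [sliceLaplacian_eq_fderiv_fderiv hq2]
  have hn : 0 < ‖v‖ := norm_pos_iff.2 hv
  have hu := hq (‖v‖⁻¹ • v) (by simp [norm_smul, hn.ne'])
  rw [smul_comm Complex.I] at hu
  simp only [map_smul, smul_apply, smul_eq_mul, ← mul_add, ← mul_assoc] at hu
  exact pos_of_mul_pos_right hu (by positivity)

theorem range_fderiv_le_tangentSpaceAt {d : ℕ} {hd : 0 < d} {M U : Set (EuclideanSpace ℂ (Fin n))}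
    {V : Set (EuclideanSpace ℝ (Fin d))} (hV : IsOpen V)
    {f : EuclideanSpace ℝ (Fin d) → EuclideanSpace ℂ (Fin n)}
    (himg : f '' (V ∩ halfSpace d hd) = M ∩ U) {x : EuclideanSpace ℝ (Fin d)}
    (hx : x ∈ V ∩ halfSpace d hd) (hf : DifferentiableAt ℝ f x) (y : EuclideanSpace ℝ (Fin d)) :
    fderiv ℝ f x y ∈ tangentSpaceAt M (f x) := by
  have hconv : Convex ℝ (halfSpace d hd) := by
    intro a ha b hb s t hs ht _
    simp only [halfSpace, mem_ofPred_eq] at ha hb ⊢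
    simp only [PiLp.add_apply, PiLp.smul_apply, smul_eq_mul]
    positivity
  have hint : (interior (halfSpace d hd)).Nonempty := by
    refine ⟨EuclideanSpace.single ⟨0, hd⟩ 1, ?_⟩
    have ho : IsOpen {x : EuclideanSpace ℝ (Fin d) | 0 < x ⟨0, hd⟩} :=
      isOpen_lt continuous_const (by fun_prop)
    refine interior_maximal (fun x hx => ?_) ho ?_
    · simp only [halfSpace, mem_ofPred_eq] at hx ⊢
      exact hx.le
    · simp
  have hu : UniqueDiffWithinAt ℝ (V ∩ halfSpace d hd) x := by
    rw [inter_comm]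
    exact (uniqueDiffOn_convex hconv hint x hx.2).inter (hV.mem_nhds hx.1)
  have htop : Submodule.span ℝ (tangentConeAt ℝ (V ∩ halfSpace d hd) x) = ⊤ := by
    have := hu.dense_tangentConeAt
    rw [Submodule.dense_iff_topologicalClosure_eq_top] at this
    rwa [(Submodule.closed_of_finiteDimensional _).submodule_topologicalClosure_eq] at this
  have hmaps := (hf.hasFDerivAt.hasFDerivWithinAt (s := V ∩ halfSpace d hd)).mapsTo_tangent_cone
  have hle : Submodule.span ℝ (tangentConeAt ℝ (V ∩ halfSpace d hd) x) ≤
      (tangentSpaceAt M (f x)).comap (fderiv ℝ f x : _ →ₗ[ℝ] _) := by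
    rw [Submodule.span_le]
    intro w hw
    refine Submodule.subset_span (tangentConeAt_mono ?_ (hmaps hw))
    rw [himg]
    exact inter_subset_left
  rw [htop] at hle
  exact hle (Submodule.mem_top (x := y))

/-- Near each of its points a submanifold lies in the zero set of a smooth map whose differential
at that point has kernel contained in the tangent space. -/
theorem IsSubmanifold.exists_vanishing_map {d : ℕ} {hd : 0 < d}
    {M : Set (EuclideanSpace ℂ (Fin n))} (hM : IsSubmanifold d hd M)
    {p : EuclideanSpace ℂ (Fin n)} (hp : p ∈ M) :
    ∃ (U : Set (EuclideanSpace ℂ (Fin n)))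
      (F : EuclideanSpace ℂ (Fin n) → EuclideanSpace ℂ (Fin n)),
      IsOpen U ∧ p ∈ U ∧ ContDiffOn ℝ (⊤ : ℕ∞) F U ∧ (∀ x ∈ M ∩ U, F x = 0) ∧
      ∀ v, fderiv ℝ F p v = 0 → v ∈ tangentSpaceAt M p := by
  obtain ⟨V, U, f, hV, hU, hpU, hf, -, hinj, himg, hopen⟩ := hM p hp
  obtain ⟨x₀, hx₀, rfl⟩ : p ∈ f '' (V ∩ halfSpace d hd) := himg ▸ ⟨hp, hpU⟩
  have hfx : ContDiffAt ℝ (⊤ : ℕ∞) f x₀ := hf.contDiffAt (hV.mem_nhds hx₀.1)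
  have hfd : DifferentiableAt ℝ f x₀ := hfx.differentiableAt (by simp)
  obtain ⟨A₀, hA₀⟩ := LinearMap.exists_leftInverse_of_injective
    (fderiv ℝ f x₀ : EuclideanSpace ℝ (Fin d) →ₗ[ℝ] EuclideanSpace ℂ (Fin n))
    (LinearMap.ker_eq_bot.2 (hinj x₀ hx₀.1))
  let A : EuclideanSpace ℂ (Fin n) →L[ℝ] EuclideanSpace ℝ (Fin d) :=
    LinearMap.toContinuousLinearMap A₀
  have hA : A.comp (fderiv ℝ f x₀) =
      (ContinuousLinearEquiv.refl ℝ (EuclideanSpace ℝ (Fin d)) :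
        EuclideanSpace ℝ (Fin d) →L[ℝ] EuclideanSpace ℝ (Fin d)) := by
    ext1 y
    exact LinearMap.congr_fun hA₀ y
  have hG : ContDiffOn ℝ (⊤ : ℕ∞) (A ∘ f) V := A.contDiff.comp_contDiffOn hf
  have hGx : ContDiffAt ℝ (⊤ : ℕ∞) (A ∘ f) x₀ := hG.contDiffAt (hV.mem_nhds hx₀.1)
  have hG' : HasFDerivAt (A ∘ f) (ContinuousLinearEquiv.refl ℝ (EuclideanSpace ℝ (Fin d)) :
        EuclideanSpace ℝ (Fin d) →L[ℝ] EuclideanSpace ℝ (Fin d)) x₀ := by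
    rw [← hA]
    exact A.hasFDerivAt.comp x₀ hfd.hasFDerivAt
  let e := hGx.toOpenPartialHomeomorph (A ∘ f) hG' (by simp)
  have he : ⇑e = A ∘ f := hGx.toOpenPartialHomeomorph_coe hG' (by simp)
  have hxe : x₀ ∈ e.source := hGx.mem_toOpenPartialHomeomorph_source hG' (by simp)
  let I : Set (EuclideanSpace ℝ (Fin d)) := V ∩ fderiv ℝ (A ∘ f) ⁻¹'
    range ((↑) : (EuclideanSpace ℝ (Fin d) ≃L[ℝ] EuclideanSpace ℝ (Fin d)) →
      EuclideanSpace ℝ (Fin d) →L[ℝ] EuclideanSpace ℝ (Fin d))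
  have hI : IsOpen I :=
    (hG.continuousOn_fderiv_of_isOpen hV (by simp)).isOpen_inter_preimage hV
      ContinuousLinearEquiv.isOpen
  have hxI : x₀ ∈ I := ⟨hx₀.1, _, hG'.fderiv.symm⟩
  let T := e.target ∩ e.symm ⁻¹' I
  have hT : IsOpen T := e.symm.isOpen_inter_preimage hI
  have hes : ContDiffOn ℝ (⊤ : ℕ∞) e.symm T := by
    rintro y ⟨hy, hyV, L, hL⟩
    have hyc : ContDiffAt ℝ (⊤ : ℕ∞) (A ∘ f) (e.symm y) := hG.contDiffAt (hV.mem_nhds hyV)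
    refine (e.contDiffAt_symm (f₀' := L) hy ?_ (by rwa [he])).contDiffWithinAt
    rw [he, hL]
    exact (hyc.differentiableAt (by simp)).hasFDerivAt
  have hTx : A (f x₀) ∈ T := by
    have h1 : A (f x₀) = e x₀ := by rw [he]; rfl
    rw [h1]
    exact ⟨e.map_source hxe, by rwa [mem_preimage, e.left_inv hxe]⟩
  have hsymm : e.symm (A (f x₀)) = x₀ := by
    have h1 : A (f x₀) = e x₀ := by rw [he]; rfl
    rw [h1, e.left_inv hxe]
  obtain ⟨U', hU', himg'⟩ := hopen (e.source ∩ V) (e.open_source.inter hV) inter_subset_right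
  refine ⟨A ⁻¹' T ∩ U', fun x => x - f (e.symm (A x)), (hT.preimage A.continuous).inter hU',
    ⟨hTx, ?_⟩, ?_, ?_, ?_⟩
  · have : f x₀ ∈ M ∩ U' := himg' ▸ mem_image_of_mem f ⟨⟨hxe, hx₀.1⟩, hx₀.2⟩
    exact this.2
  · refine contDiffOn_id.sub (hf.comp (hes.comp A.contDiff.contDiffOn fun x hx => hx.1) ?_)
    exact fun x hx => hx.1.2.1
  · rintro x ⟨hxM, -, hxU'⟩
    obtain ⟨y, hy, rfl⟩ : x ∈ f '' (e.source ∩ V ∩ halfSpace d hd) := himg' ▸ ⟨hxM, hxU'⟩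
    have h1 : A (f y) = e y := by rw [he]; rfl
    change f y - f (e.symm (A (f y))) = 0
    rw [h1, e.left_inv hy.1.1, sub_self]
  · intro v hv
    have h1 : HasFDerivAt e.symm ((ContinuousLinearEquiv.refl ℝ (EuclideanSpace ℝ (Fin d))).symm :
        EuclideanSpace ℝ (Fin d) →L[ℝ] EuclideanSpace ℝ (Fin d)) (A (f x₀)) := by
      refine e.hasFDerivAt_symm hTx.1 ?_
      rw [hsymm, he]
      exact hG'
    have h2 : HasFDerivAt f (fderiv ℝ f x₀) (e.symm (A (f x₀))) := by
      rw [hsymm]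
      exact hfd.hasFDerivAt
    have h3 : HasFDerivAt (fun x => x - f (e.symm (A x))) _ (f x₀) :=
      (hasFDerivAt_id (f x₀)).sub (h2.comp (f x₀) (h1.comp (f x₀) A.hasFDerivAt))
    rw [h3.fderiv] at hv
    have h4 : v = fderiv ℝ f x₀ (A v) := by
      simpa [sub_eq_zero] using hv
    rw [h4]
    exact range_fderiv_le_tangentSpaceAt hV himg hx₀ hfd (A v)

/-- Near a totally real point a closed submanifold is the zero set of a smooth nonnegative strictly
plurisubharmonic function. -/
theorem exists_strictPsh_of_totallyRealAt {d : ℕ} {hd : 0 < d}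
    {M : Set (EuclideanSpace ℂ (Fin n))} (hM : IsSubmanifold d hd M) (hMc : IsClosed M)
    {p : EuclideanSpace ℂ (Fin n)} (hp : p ∈ M) (htr : TotallyRealAt M p) :
    ∃ (U : Set (EuclideanSpace ℂ (Fin n))) (r : EuclideanSpace ℂ (Fin n) → ℝ),
      IsOpen U ∧ p ∈ U ∧ ContDiffOn ℝ (⊤ : ℕ∞) r U ∧ (∀ x ∈ U, 0 ≤ r x) ∧
      (∀ x ∈ U, r x = 0 ↔ x ∈ M) ∧ StrictPshOn r U := by
  obtain ⟨U, F, hU, hpU, hF, hF0, hker⟩ := hM.exists_vanishing_map hp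
  obtain ⟨h, hsupp, hh, hrange⟩ := hMc.isOpen_compl.exists_contDiff_support_eq (n := ⊤)
  have hzero : ∀ x, h x = 0 ↔ x ∈ M := fun x => by
    rw [← not_iff_not, ← mem_compl_iff (s := M), ← hsupp, Function.mem_support]
  have hFi : ∀ i, ContDiffOn ℝ (⊤ : ℕ∞) (fun x => F x i) U := fun i =>
    (EuclideanSpace.proj (𝕜 := ℂ) i).restrictScalars ℝ |>.contDiff.comp_contDiffOn hF
  let r : EuclideanSpace ℂ (Fin n) → ℝ := fun x => ∑ i, Complex.normSq (F x i) + h x * h x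
  have hr : ContDiffOn ℝ (⊤ : ℕ∞) r U := by
    refine ContDiffOn.add (ContDiffOn.sum fun i _ => ?_) (hh.mul hh).contDiffOn
    simp only [Complex.normSq_apply]
    have h1 := Complex.reCLM.contDiff.comp_contDiffOn (hFi i)
    have h2 := Complex.imCLM.contDiff.comp_contDiffOn (hFi i)
    exact (h1.mul h1).add (h2.mul h2)
  have hrp : ContDiffAt ℝ 2 r p := (hr.contDiffAt (hU.mem_nhds hpU)).of_le two_le_infty
  have hstrict : StrictPshAt r p := by
    intro v hv
    have hl : ContDiffAt ℝ 2 (fun t : ℂ => p + t • v) 0 := by fun_prop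
    have hp0 : p + (0 : ℂ) • v = p := by simp
    have hFp : ContDiffAt ℝ 2 F (p + (0 : ℂ) • v) := by
      rw [hp0]
      exact (hF.contDiffAt (hU.mem_nhds hpU)).of_le two_le_infty
    have hslice : ∀ i, ∃ b c d, HasJet (fun t : ℂ => F (p + t • v) i) 0 b c d ∧
        fderiv ℝ F p v i = b + c ∧ fderiv ℝ F p (Complex.I • v) i = Complex.I * (b - c) := by
      intro i
      let P : EuclideanSpace ℂ (Fin n) →L[ℝ] ℂ :=
        (EuclideanSpace.proj (𝕜 := ℂ) i).restrictScalars ℝ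
      have hs : ContDiffAt ℝ 2 (fun t : ℂ => F (p + t • v) i) 0 :=
        P.contDiff.contDiffAt.comp (0 : ℂ) (hFp.comp (0 : ℂ) hl)
      obtain ⟨b, c, d, hj, h1, h2⟩ := hs.exists_hasJet
      have hd : HasFDerivAt (fun t : ℂ => F (p + t • v) i)
          (P.comp ((fderiv ℝ F p).comp
            ((ContinuousLinearMap.toSpanSingleton ℂ v).restrictScalars ℝ))) 0 := by
        refine P.hasFDerivAt.comp (0 : ℂ) (HasFDerivAt.comp (0 : ℂ) (g := F) ?_ ?_)
        · rw [hp0]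
          rw [hp0] at hFp
          exact (hFp.differentiableAt (by simp)).hasFDerivAt
        · simpa using ((ContinuousLinearMap.toSpanSingleton ℂ v).restrictScalars
            ℝ).hasFDerivAt.const_add p
      rw [hd.fderiv] at h1 h2
      refine ⟨b, c, d, ?_, by simpa [P] using h1, by simpa [P] using h2⟩
      simpa [hF0 p ⟨hp, hpU⟩] using hj
    choose b c d hj h1 h2 using hslice
    obtain ⟨b', c', d', hj', -, hz⟩ :=
      (hh.contDiffAt.of_le two_le_infty : ContDiffAt ℝ 2 h p).exists_hasJet_slice v
    have hh0 : h p = 0 := (hzero p).2 hp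
    have hmin : fderiv ℝ h p = 0 := IsLocalMin.fderiv_eq_zero <| Eventually.of_forall fun x => by
      rw [hh0]
      exact (hrange (mem_range_self x)).1
    obtain ⟨rfl, rfl⟩ := hz hmin
    have hjet := (HasJet.sum (s := Finset.univ) fun i _ => (hj i).normSq).add (hj'.mul hj')
    have := HasJet.sliceLaplacian_eq (ρ := r) (p := p) (v := v) (by
      simpa only [r, Complex.ofReal_add, Complex.ofReal_sum, Complex.ofReal_mul] using hjet)
    rw [this]
    simp only [hh0, Complex.ofReal_zero, map_zero, zero_mul, mul_zero, add_zero,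
      ← Complex.ofReal_add, ← Complex.ofReal_sum, Complex.ofReal_re]
    have hnn : ∀ i, 0 ≤ Complex.normSq (b i) + Complex.normSq (c i) := fun i =>
      add_nonneg (Complex.normSq_nonneg _) (Complex.normSq_nonneg _)
    by_contra! hle
    have hs0 : ∑ i, (Complex.normSq (b i) + Complex.normSq (c i)) = 0 :=
      le_antisymm (by linarith) (Finset.sum_nonneg fun i _ => hnn i)
    rw [Finset.sum_eq_zero_iff_of_nonneg fun i _ => hnn i] at hs0
    have hbc : ∀ i, b i = 0 ∧ c i = 0 := fun i => by
      have := hs0 i (Finset.mem_univ i)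
      rw [add_eq_zero_iff_of_nonneg (Complex.normSq_nonneg _) (Complex.normSq_nonneg _)] at this
      simpa using this
    refine hv (htr v (hker v ?_) (hker _ ?_))
    · ext i
      simp [h1 i, hbc i]
    · ext i
      simp [h2 i, hbc i]
  obtain ⟨W, hW, hWo, hpW⟩ := eventually_nhds_iff.1 (hstrict.eventually hrp)
  have hnn : ∀ x, 0 ≤ ∑ i, Complex.normSq (F x i) := fun x =>
    Finset.sum_nonneg fun i _ => Complex.normSq_nonneg _
  refine ⟨U ∩ W, r, hU.inter hWo, ⟨hpU, hpW⟩, hr.mono inter_subset_left, fun x _ =>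
    add_nonneg (hnn x) (mul_self_nonneg _), fun x hx => ⟨fun h0 => ?_, fun hxM => ?_⟩,
    fun q hq => hW q hq.2⟩
  · rw [← hzero]
    have h1 := hnn x
    have h2 := mul_self_nonneg (h x)
    exact mul_self_eq_zero.1 (by simp only [r] at h0; linarith)
  · simp [r, hF0 x ⟨hxM, hx.1⟩, (hzero x).2 hxM]

end TotallyReal

section Model

open Filter Topology

/-- The holomorphic parts of the functions `modelDefect` vanishing on the normal form, in terms of
the coordinates `x`. -/
def modelHol (k : ℕ) (x : ℕ → ℂ) : Fin (2 * k - 2) ⊕ Fin (k - 2) ⊕ Fin 4 → ℂ :=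
  Sum.elim (fun τ => x (τ + 1)) (Sum.elim (fun σ => x (2 * k + σ))
    ![x (3 * k - 2), x (2 * k - 1) + x 0 * (x 1 - Complex.I * x 2),
      (x 0 - (x 1 + Complex.I * x 2)) * x (2 * k - 1),
      x (2 * k - 1) * x (2 * k - 1) - x (3 * k - 2) *
        ((x 0 + (x 1 + Complex.I * x 2)) * (x 0 + (x 1 + Complex.I * x 2)))])

/-- The conjugates of the antiholomorphic parts of the functions `modelDefect`. -/
def modelAntihol (k : ℕ) (x : ℕ → ℂ) : Fin (2 * k - 2) ⊕ Fin (k - 2) ⊕ Fin 4 → ℂ :=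
  Sum.elim (fun τ => x (τ + 1))
    (Sum.elim (fun σ => x 0 * (x (2 * σ + 3) - Complex.I * x (2 * σ + 4)))
      ![x 0 * x 0, x (2 * k - 1) + x 0 * (x 1 - Complex.I * x 2),
        x 0 * (x (3 * k - 2) - (x 1 - Complex.I * x 2) * (x 1 - Complex.I * x 2)), 0])

/-- The derivative of `modelHol` at `x` in the direction `y`. -/
def modelHolDeriv (k : ℕ) (x y : ℕ → ℂ) : Fin (2 * k - 2) ⊕ Fin (k - 2) ⊕ Fin 4 → ℂ :=
  Sum.elim (fun τ => y (τ + 1)) (Sum.elim (fun σ => y (2 * k + σ))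
    ![y (3 * k - 2),
      y (2 * k - 1) + (x 0 * (y 1 - Complex.I * y 2) + (x 1 - Complex.I * x 2) * y 0),
      (x 0 - (x 1 + Complex.I * x 2)) * y (2 * k - 1) +
        x (2 * k - 1) * (y 0 - (y 1 + Complex.I * y 2)),
      x (2 * k - 1) * y (2 * k - 1) + x (2 * k - 1) * y (2 * k - 1) - (x (3 * k - 2) *
        ((x 0 + (x 1 + Complex.I * x 2)) * (y 0 + (y 1 + Complex.I * y 2)) +
          (x 0 + (x 1 + Complex.I * x 2)) * (y 0 + (y 1 + Complex.I * y 2))) +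
        (x 0 + (x 1 + Complex.I * x 2)) * (x 0 + (x 1 + Complex.I * x 2)) * y (3 * k - 2))])

/-- The derivative of `modelAntihol` at `x` in the direction `y`. -/
def modelAntiholDeriv (k : ℕ) (x y : ℕ → ℂ) : Fin (2 * k - 2) ⊕ Fin (k - 2) ⊕ Fin 4 → ℂ :=
  Sum.elim (fun τ => y (τ + 1))
    (Sum.elim (fun σ => x 0 * (y (2 * σ + 3) - Complex.I * y (2 * σ + 4)) +
        (x (2 * σ + 3) - Complex.I * x (2 * σ + 4)) * y 0)
      ![x 0 * y 0 + x 0 * y 0,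
        y (2 * k - 1) + (x 0 * (y 1 - Complex.I * y 2) + (x 1 - Complex.I * x 2) * y 0),
        x 0 * (y (3 * k - 2) - ((x 1 - Complex.I * x 2) * (y 1 - Complex.I * y 2) +
            (x 1 - Complex.I * x 2) * (y 1 - Complex.I * y 2))) +
          (x (3 * k - 2) - (x 1 - Complex.I * x 2) * (x 1 - Complex.I * x 2)) * y 0, 0])

/-- Pluriharmonic functions of the coordinates vanishing on the normal form. -/
def modelDefect (k : ℕ) (x : ℕ → ℂ) (j : Fin (2 * k - 2) ⊕ Fin (k - 2) ⊕ Fin 4) : ℂ :=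
  modelHol k x j - conj (modelAntihol k x j)

/-- The equation of the normal form for `ζ₁`, multiplied by `z²`. -/
def modelCubic (k : ℕ) (x : ℕ → ℂ) : ℂ :=
  x 0 * x 0 * (x (2 * k - 1) - conj (x 0) * (x 0 + (x 1 + Complex.I * x 2)))

/-- A plurisubharmonic function of the coordinates whose zero set is the normal form. -/
def modelFun (k : ℕ) (x : ℕ → ℂ) : ℝ :=
  ∑ j, (1 + Complex.normSq (x 0)) * Complex.normSq (modelDefect k x j) +
    Complex.normSq (modelCubic k x)

theorem modelFun_nonneg (k : ℕ) (x : ℕ → ℂ) : 0 ≤ modelFun k x :=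
  add_nonneg (Finset.sum_nonneg fun _ _ => mul_nonneg
    (add_nonneg zero_le_one (Complex.normSq_nonneg _)) (Complex.normSq_nonneg _))
    (Complex.normSq_nonneg _)

theorem modelFun_eq_zero_iff (k : ℕ) (x : ℕ → ℂ) :
    modelFun k x = 0 ↔ (∀ j, modelDefect k x j = 0) ∧ modelCubic k x = 0 := by
  have hpos : 0 < 1 + Complex.normSq (x 0) := add_pos_of_pos_of_nonneg one_pos
    (Complex.normSq_nonneg _)
  have hnn : ∀ j, 0 ≤ (1 + Complex.normSq (x 0)) * Complex.normSq (modelDefect k x j) := fun j =>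
    mul_nonneg hpos.le (Complex.normSq_nonneg _)
  rw [modelFun, add_eq_zero_iff_of_nonneg (Finset.sum_nonneg fun j _ => hnn j)
    (Complex.normSq_nonneg _), Finset.sum_eq_zero_iff_of_nonneg fun j _ => hnn j]
  simp [hpos.ne']

section Jets

variable {g h : ℂ → ℂ} {a b a' b' : ℂ}

theorem HasJet.of_eq {c d d' : ℂ} (hg : HasJet g a b c d) (hd : d = d') : HasJet g a b c d' :=
  hd ▸ hg

theorem HasJet.mul_of_holomorphic (hg : HasJet g a b 0 0) (hh : HasJet h a' b' 0 0) :
    HasJet (fun t => g t * h t) (a * a') (a * b' + a' * b) 0 0 := by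
  simpa using hg.mul hh

theorem HasJet.add_of_holomorphic (hg : HasJet g a b 0 0) (hh : HasJet h a' b' 0 0) :
    HasJet (fun t => g t + h t) (a + a') (b + b') 0 0 := by
  simpa using hg.add hh

theorem HasJet.sub_of_holomorphic (hg : HasJet g a b 0 0) (hh : HasJet h a' b' 0 0) :
    HasJet (fun t => g t - h t) (a - a') (b - b') 0 0 := by
  simpa using hg.sub hh

theorem HasJet.const_mul_of_holomorphic (c : ℂ) (hg : HasJet g a b 0 0) :
    HasJet (fun t => c * g t) (c * a) (c * b) 0 0 := by
  simpa using (HasJet.const c).mul hg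

end Jets

variable {k : ℕ} {x : ℕ → ℂ → ℂ} {X Y : ℕ → ℂ}

theorem hasJet_modelHol (hx : ∀ i, HasJet (x i) (X i) (Y i) 0 0) (j) :
    HasJet (fun t => modelHol k (fun i => x i t) j) (modelHol k X j) (modelHolDeriv k X Y j)
      0 0 := by
  have ha := (hx 1).add_of_holomorphic ((hx 2).const_mul_of_holomorphic Complex.I)
  have hb := (hx 1).sub_of_holomorphic ((hx 2).const_mul_of_holomorphic Complex.I)
  rcases j with τ | σ | j
  · exact hx _
  · exact hx _
  · fin_cases j
    · exact hx _
    · exact (hx _).add_of_holomorphic ((hx 0).mul_of_holomorphic hb)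
    · exact ((hx 0).sub_of_holomorphic ha).mul_of_holomorphic (hx _)
    · exact ((hx _).mul_of_holomorphic (hx _)).sub_of_holomorphic
        ((hx _).mul_of_holomorphic (((hx 0).add_of_holomorphic ha).mul_of_holomorphic
          ((hx 0).add_of_holomorphic ha)))

theorem hasJet_modelAntihol (hx : ∀ i, HasJet (x i) (X i) (Y i) 0 0) (j) :
    HasJet (fun t => modelAntihol k (fun i => x i t) j) (modelAntihol k X j)
      (modelAntiholDeriv k X Y j) 0 0 := by
  have hb := (hx 1).sub_of_holomorphic ((hx 2).const_mul_of_holomorphic Complex.I)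
  rcases j with τ | σ | j
  · exact hx _
  · exact (hx 0).mul_of_holomorphic
      ((hx _).sub_of_holomorphic ((hx _).const_mul_of_holomorphic Complex.I))
  · fin_cases j
    · exact (hx 0).mul_of_holomorphic (hx 0)
    · exact (hx _).add_of_holomorphic ((hx 0).mul_of_holomorphic hb)
    · exact (hx 0).mul_of_holomorphic ((hx _).sub_of_holomorphic (hb.mul_of_holomorphic hb))
    · exact HasJet.const 0

theorem hasJet_modelDefect (hx : ∀ i, HasJet (x i) (X i) (Y i) 0 0) (j) :
    HasJet (fun t => modelDefect k (fun i => x i t) j) (modelDefect k X j) (modelHolDeriv k X Y j)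
      (-conj (modelAntiholDeriv k X Y j)) 0 := by
  simpa [modelDefect] using (hasJet_modelHol hx j).sub (hasJet_modelAntihol hx j).conj

theorem exists_hasJet_modelCubic (hx : ∀ i, HasJet (x i) (X i) (Y i) 0 0) :
    ∃ b c, HasJet (fun t => modelCubic k (fun i => x i t)) (modelCubic k X) b c
      (-(conj (Y 0) * (X 0 * ((3 * X 0 + 2 * (X 1 + Complex.I * X 2)) * Y 0 +
        X 0 * (Y 1 + Complex.I * Y 2))))) := by
  have ha := (hx 1).add_of_holomorphic ((hx 2).const_mul_of_holomorphic Complex.I)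
  have hzz := (hx 0).mul_of_holomorphic (hx 0)
  have := hzz.mul ((hx (2 * k - 1)).sub ((hx 0).conj.mul ((hx 0).add_of_holomorphic ha)))
  refine ⟨_, _, this.of_eq ?_⟩
  simp only [map_zero]
  ring

theorem exists_hasJet_weighted {z F : ℂ → ℂ} {Z D A B C : ℂ} (hz : HasJet z Z D 0 0)
    (hF : HasJet F A B C 0) (hZ : ‖Z‖ ≤ 1 / 4) :
    ∃ a b c d, HasJet (fun t => (((1 + Complex.normSq (z t)) * Complex.normSq (F t) : ℝ) : ℂ))
      a b c d ∧ (Complex.normSq B + Complex.normSq C + Complex.normSq A * Complex.normSq D) / 2 ≤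
        d.re := by
  have h := ((HasJet.const 1).add hz.normSq).mul hF.normSq
  refine ⟨_, _, _, _, by simpa using h, ?_⟩
  have key : ∀ u : ℂ, -‖u‖ ≤ u.re := fun u => (abs_le.1 (Complex.abs_re_le_norm u)).1
  have h1 := key (conj Z * D * (A * conj B))
  have h2 := key (conj Z * D * (conj A * C))
  have h3 := key (Z * conj D * (A * conj C))
  have h4 := key (Z * conj D * (conj A * B))
  simp only [norm_mul, Complex.norm_conj] at h1 h2 h3 h4
  have hn := norm_nonneg Z
  have hX : 0 ≤ ‖D‖ * ‖A‖ := by positivity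
  have e1 : ‖Z‖ * (‖D‖ * ‖A‖ * (‖B‖ + ‖C‖)) ≤ 1 / 4 * (‖D‖ * ‖A‖ * (‖B‖ + ‖C‖)) := by
    gcongr
  have e2 : 0 ≤ ‖Z‖ ^ 2 * (‖B‖ ^ 2 + ‖C‖ ^ 2) := by positivity
  have expand : ((1 + (Complex.normSq Z : ℂ)) * (Complex.normSq B + Complex.normSq C) +
      (Complex.normSq A) * (Complex.normSq D) + (conj Z * D * (A * conj B) + conj Z * D *
        (conj A * C)) + (Z * conj D * (A * conj C) + Z * conj D * (conj A * B))).re =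
      (1 + ‖Z‖ ^ 2) * (‖B‖ ^ 2 + ‖C‖ ^ 2) + ‖A‖ ^ 2 * ‖D‖ ^ 2 +
        ((conj Z * D * (A * conj B)).re + (conj Z * D * (conj A * C)).re) +
        ((Z * conj D * (A * conj C)).re + (Z * conj D * (conj A * B)).re) := by
    simp only [Complex.add_re, ← Complex.normSq_eq_norm_sq, ← Complex.ofReal_mul,
      ← Complex.ofReal_add, ← Complex.ofReal_one, Complex.ofReal_re]
  simp only [Complex.normSq_eq_norm_sq]
  calc _ ≤ _ := ?_
    _ = _ := expand.symm
    _ = _ := by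
      congr 1
      simp [Complex.normSq_eq_norm_sq]
      ring
  nlinarith [sq_nonneg (‖D‖ * ‖A‖ - (‖B‖ + ‖C‖)), sq_nonneg (‖B‖ - ‖C‖)]

/-- A lower bound, up to a factor, for the Levi form of `modelFun` at `X` in the direction `Y`. -/
def modelLevi (k : ℕ) (X Y : ℕ → ℂ) : ℝ :=
  ∑ j, (Complex.normSq (modelHolDeriv k X Y j) + Complex.normSq (modelAntiholDeriv k X Y j) +
    Complex.normSq (modelDefect k X j) * Complex.normSq (Y 0))

theorem modelLevi_term_nonneg (k : ℕ) (X Y : ℕ → ℂ) (j) :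
    0 ≤ Complex.normSq (modelHolDeriv k X Y j) + Complex.normSq (modelAntiholDeriv k X Y j) +
      Complex.normSq (modelDefect k X j) * Complex.normSq (Y 0) :=
  add_nonneg (add_nonneg (Complex.normSq_nonneg _) (Complex.normSq_nonneg _))
    (mul_nonneg (Complex.normSq_nonneg _) (Complex.normSq_nonneg _))

theorem modelLevi_nonneg (k : ℕ) (X Y : ℕ → ℂ) : 0 ≤ modelLevi k X Y :=
  Finset.sum_nonneg fun j _ => modelLevi_term_nonneg k X Y j

theorem le_modelLevi (hk : 1 < k) :
    4 * (‖X 0‖ * ‖Y 0‖) ^ 2 + ‖Y 1‖ ^ 2 + ‖Y 2‖ ^ 2 ≤ modelLevi k X Y := by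
  have h := Finset.sum_le_sum_of_subset_of_nonneg
    (Finset.subset_univ ({Sum.inl ⟨0, by omega⟩, Sum.inl ⟨1, by omega⟩, Sum.inr (Sum.inr 0)} :
      Finset (Fin (2 * k - 2) ⊕ Fin (k - 2) ⊕ Fin 4)))
    fun j _ _ => modelLevi_term_nonneg k X Y j
  refine le_trans ?_ h
  rw [Finset.sum_insert (by simp), Finset.sum_insert (by simp), Finset.sum_singleton]
  have h1 := mul_nonneg (Complex.normSq_nonneg (modelDefect k X (Sum.inl ⟨0, by omega⟩)))
    (Complex.normSq_nonneg (Y 0))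
  have h2 := mul_nonneg (Complex.normSq_nonneg (modelDefect k X (Sum.inl ⟨1, by omega⟩)))
    (Complex.normSq_nonneg (Y 0))
  have h3 := mul_nonneg (Complex.normSq_nonneg (modelDefect k X (Sum.inr (Sum.inr 0))))
    (Complex.normSq_nonneg (Y 0))
  have e : Complex.normSq (X 0 * Y 0 + X 0 * Y 0) = 4 * (‖X 0‖ * ‖Y 0‖) ^ 2 := by
    rw [← two_mul, Complex.normSq_eq_norm_sq, norm_mul, norm_mul]
    norm_num
    ring
  have h4 := Complex.normSq_nonneg (Y (3 * k - 2))
  simp only [modelHolDeriv, modelAntiholDeriv, Sum.elim_inl, Sum.elim_inr, Matrix.cons_val_zero, e]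
  simp only [zero_add, one_add_one_eq_two, Complex.normSq_eq_norm_sq (Y 1),
    Complex.normSq_eq_norm_sq (Y 2)]
  nlinarith [sq_nonneg ‖Y 1‖, sq_nonneg ‖Y 2‖]

theorem exists_hasJet_modelFun (hk : 1 < k) (hx : ∀ i, HasJet (x i) (X i) (Y i) 0 0)
    (hX : ∀ i, ‖X i‖ ≤ 1 / 10) :
    ∃ a b c d, HasJet (fun t => (modelFun k (fun i => x i t) : ℂ)) a b c d ∧
      modelLevi k X Y / 4 ≤ d.re := by
  choose a b c d hj hd using fun j => exists_hasJet_weighted (hx 0) (hasJet_modelDefect (k := k) hx j)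
    ((hX 0).trans (by norm_num))
  obtain ⟨b', c', hj'⟩ := exists_hasJet_modelCubic (k := k) hx
  have hsum := (HasJet.sum (s := Finset.univ) fun j _ => hj j).add hj'.normSq
  refine ⟨_, _, _, _, by
    simpa only [modelFun, Complex.ofReal_add, Complex.ofReal_sum] using hsum, ?_⟩
  have hL : modelLevi k X Y / 2 ≤ (∑ j, d j).re := by
    rw [Complex.re_sum, modelLevi, Finset.sum_div]
    refine Finset.sum_le_sum fun j _ => ?_
    simpa using hd j
  have hle := le_modelLevi (X := X) (Y := Y) hk
  set A := modelCubic k X with hA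
  set D := conj (Y 0) * (X 0 * ((3 * X 0 + 2 * (X 1 + Complex.I * X 2)) * Y 0 +
        X 0 * (Y 1 + Complex.I * Y 2))) with hD
  have hre : -(2 * (‖A‖ * ‖D‖)) ≤ (A * conj (-D) + conj A * -D).re := by
    have h1 := (abs_le.1 (Complex.abs_re_le_norm (A * conj (-D)))).1
    have h2 := (abs_le.1 (Complex.abs_re_le_norm (conj A * -D))).1
    simp only [norm_mul, Complex.norm_conj, norm_neg] at h1 h2
    rw [Complex.add_re]
    linarith
  have ha : ‖X 1 + Complex.I * X 2‖ ≤ 2 / 10 := by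
    refine (norm_add_le _ _).trans ?_
    rw [norm_mul, Complex.norm_I, one_mul]
    linarith [hX 1, hX 2]
  have hAn : ‖A‖ ≤ ‖X 0‖ ^ 2 * (13 / 100) := by
    rw [hA, modelCubic, norm_mul, norm_mul, ← sq]
    refine mul_le_mul_of_nonneg_left ((norm_sub_le _ _).trans ?_) (sq_nonneg _)
    rw [norm_mul, Complex.norm_conj]
    have h1 : ‖X 0 + (X 1 + Complex.I * X 2)‖ ≤ 3 / 10 :=
      (norm_add_le _ _).trans (by linarith [hX 0])
    have h2 := mul_le_mul (hX 0) h1 (norm_nonneg _) (by norm_num)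
    linarith [hX (2 * k - 1)]
  have hDn : ‖D‖ ≤ ‖X 0‖ * ‖Y 0‖ * (7 / 10 * ‖Y 0‖ + ‖X 0‖ * (‖Y 1‖ + ‖Y 2‖)) := by
    have h1 : ‖3 * X 0 + 2 * (X 1 + Complex.I * X 2)‖ ≤ 7 / 10 := by
      refine (norm_add_le _ _).trans ?_
      rw [norm_mul, norm_mul]
      norm_num
      linarith [hX 0]
    have h2 : ‖Y 1 + Complex.I * Y 2‖ ≤ ‖Y 1‖ + ‖Y 2‖ := by
      refine (norm_add_le _ _).trans ?_
      rw [norm_mul, Complex.norm_I, one_mul]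
    rw [hD, norm_mul, norm_mul, Complex.norm_conj, ← mul_assoc, mul_comm ‖Y 0‖]
    refine mul_le_mul_of_nonneg_left ((norm_add_le _ _).trans ?_) (by positivity)
    rw [norm_mul, norm_mul]
    gcongr
  have hAD : ‖A‖ * ‖D‖ ≤ 1 / 10 * (‖X 0‖ * ‖Y 0‖) ^ 2 +
      1 / 100 * (‖X 0‖ * ‖Y 0‖) * (‖Y 1‖ + ‖Y 2‖) := by
    have hz := hX 0
    have hz0 := norm_nonneg (X 0)
    calc ‖A‖ * ‖D‖ ≤ (‖X 0‖ ^ 2 * (13 / 100)) *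
          (‖X 0‖ * ‖Y 0‖ * (7 / 10 * ‖Y 0‖ + ‖X 0‖ * (‖Y 1‖ + ‖Y 2‖))) := by gcongr
      _ = 91 / 1000 * ‖X 0‖ * (‖X 0‖ * ‖Y 0‖) ^ 2 +
          13 / 100 * ‖X 0‖ ^ 3 * (‖X 0‖ * ‖Y 0‖) * (‖Y 1‖ + ‖Y 2‖) := by ring
      _ ≤ 91 / 1000 * (1 / 10) * (‖X 0‖ * ‖Y 0‖) ^ 2 +
          13 / 100 * (1 / 10) ^ 3 * (‖X 0‖ * ‖Y 0‖) * (‖Y 1‖ + ‖Y 2‖) := by gcongr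
      _ ≤ _ := by
        gcongr
        · norm_num
        · norm_num
  rw [Complex.add_re, Complex.add_re (_ + _)]
  have hb : 0 ≤ ((Complex.normSq b' : ℂ) + Complex.normSq c').re := by
    rw [← Complex.ofReal_add, Complex.ofReal_re]
    exact add_nonneg (Complex.normSq_nonneg _) (Complex.normSq_nonneg _)
  nlinarith [sq_nonneg (‖X 0‖ * ‖Y 0‖ - ‖Y 1‖), sq_nonneg (‖X 0‖ * ‖Y 0‖ - ‖Y 2‖)]

/-- The Levi form of `modelFun` degenerates only at the origin. -/
theorem eq_zero_or_eq_zero_of_modelLevi_eq_zero (hk : 1 < k) (h : modelLevi k X Y = 0) :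
    (∀ i < 3 * k - 1, Y i = 0) ∨ ∀ i < 3 * k - 1, X i = 0 := by
  rw [modelLevi, Finset.sum_eq_zero_iff_of_nonneg fun j _ => modelLevi_term_nonneg k X Y j] at h
  have hall : ∀ j, (modelHolDeriv k X Y j = 0 ∧ modelAntiholDeriv k X Y j = 0) ∧
      (modelDefect k X j = 0 ∨ Y 0 = 0) := fun j => by
    have := h j (Finset.mem_univ j)
    rw [add_eq_zero_iff_of_nonneg (add_nonneg (Complex.normSq_nonneg _) (Complex.normSq_nonneg _))
      (mul_nonneg (Complex.normSq_nonneg _) (Complex.normSq_nonneg _)),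
      add_eq_zero_iff_of_nonneg (Complex.normSq_nonneg _) (Complex.normSq_nonneg _)] at this
    simpa using this
  have hw : ∀ i, 1 ≤ i → i ≤ 2 * k - 2 → Y i = 0 ∧ ((X i).im = 0 ∨ Y 0 = 0) := fun i h1 h2 => by
    have := hall (Sum.inl ⟨i - 1, by omega⟩)
    simp only [modelHolDeriv, modelDefect, modelHol, modelAntihol, Sum.elim_inl,
      Nat.sub_add_cancel h1, sub_eq_zero] at this
    exact ⟨this.1.1, this.2.imp_left fun e => Complex.conj_eq_iff_im.1 e.symm⟩
  have hζ : ∀ i, 2 * k ≤ i → i < 3 * k - 2 → Y i = 0 := fun i h1 h2 => by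
    have := (hall (Sum.inr (Sum.inl ⟨i - 2 * k, by omega⟩))).1.1
    simpa [modelHolDeriv, Nat.add_sub_cancel' h1] using this
  have hY1 : Y 1 = 0 := (hw 1 le_rfl (by omega)).1
  have hY2 : Y 2 = 0 := (hw 2 (by omega) (by omega)).1
  obtain ⟨⟨ht, hz⟩, ht'⟩ := hall (Sum.inr (Sum.inr 0))
  have hs := (hall (Sum.inr (Sum.inr 1))).1.1
  have hb := (hall (Sum.inr (Sum.inr 2))).1.2
  have hH := (hall (Sum.inr (Sum.inr 3))).2
  simp only [modelHolDeriv, modelAntiholDeriv, modelDefect, modelHol, modelAntihol, Sum.elim_inr,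
    Matrix.cons_val] at ht hz ht' hs hb hH
  by_cases hz0 : Y 0 = 0
  · left
    intro i hi
    rcases Nat.eq_zero_or_pos i with rfl | hpos
    · exact hz0
    rcases le_or_gt i (2 * k - 2) with h1 | h1
    · exact (hw i hpos h1).1
    rcases Nat.lt_or_ge i (2 * k) with h2 | h2
    · obtain rfl : i = 2 * k - 1 := by omega
      simpa [hY1, hY2, hz0] using hs
    rcases Nat.lt_or_ge i (3 * k - 2) with h3 | h3
    · exact hζ i h2 h3
    · obtain rfl : i = 3 * k - 2 := by omega
      exact ht
  · right
    have hX0 : X 0 = 0 := by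
      rw [← two_mul] at hz
      simpa [hz0] using hz
    have hXt : X (3 * k - 2) = 0 := by simpa [hX0, hz0] using ht'
    have hXs : X (2 * k - 1) = 0 := by simpa [hX0, hz0, hXt] using hH
    have him : ∀ i, 1 ≤ i → i ≤ 2 * k - 2 → (X i).im = 0 := fun i h1 h2 =>
      (hw i h1 h2).2.resolve_right hz0
    have hpair : ∀ i, 1 ≤ i → i + 1 ≤ 2 * k - 2 → X i - Complex.I * X (i + 1) = 0 →
        X i = 0 ∧ X (i + 1) = 0 := fun i h1 h2 e => by
      have e1 := him i h1 (by omega)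
      have e2 := him (i + 1) (by omega) h2
      have er := congrArg Complex.re e
      have ei := congrArg Complex.im e
      simp [e1, e2] at er ei
      exact ⟨Complex.ext er e1, Complex.ext ei e2⟩
    have hXζ : ∀ i (h1 : 2 * k ≤ i) (h2 : i < 3 * k - 2), X i = 0 := fun i h1 h2 => by
      have := (hall (Sum.inr (Sum.inl ⟨i - 2 * k, by omega⟩))).2.resolve_right hz0
      simpa [modelDefect, modelHol, modelAntihol, Nat.add_sub_cancel' h1, hX0] using this
    have hβ : ∀ i, i < k - 2 → X (2 * i + 3) = 0 ∧ X (2 * i + 4) = 0 := fun i hi => by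
      have := (hall (Sum.inr (Sum.inl ⟨i, hi⟩))).1.2
      simp only [modelAntiholDeriv, Sum.elim_inl, Sum.elim_inr, hX0, zero_mul, zero_add,
        mul_eq_zero, hz0, or_false] at this
      exact hpair _ (by omega) (by omega) this
    have h12 : X 1 = 0 ∧ X 2 = 0 := by
      refine hpair 1 le_rfl (by omega) ?_
      simpa [hX0, hXt, hz0] using hb
    intro i hi
    rcases Nat.eq_zero_or_pos i with rfl | hpos
    · exact hX0
    rcases le_or_gt i (2 * k - 2) with h1 | h1
    · rcases Nat.lt_or_ge i 3 with h3 | h3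
      · interval_cases i
        · exact h12.1
        · exact h12.2
      · rcases Nat.even_or_odd' i with ⟨m, rfl | rfl⟩
        · have := (hβ (m - 2) (by omega)).2
          rwa [show 2 * (m - 2) + 4 = 2 * m by omega] at this
        · have := (hβ (m - 1) (by omega)).1
          rwa [show 2 * (m - 1) + 3 = 2 * m + 1 by omega] at this
    rcases Nat.lt_or_ge i (2 * k) with h2 | h2
    · obtain rfl : i = 2 * k - 1 := by omega
      exact hXs
    rcases Nat.lt_or_ge i (3 * k - 2) with h3 | h3
    · exact hXζ i h2 h3
    · obtain rfl : i = 3 * k - 2 := by omega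
      exact hXt

theorem modelFun_eq_zero_iff_normalForm (hk : 1 < k) : modelFun k X = 0 ↔
    (∀ τ : ℕ, 1 ≤ τ → τ ≤ 2 * k - 2 → (X τ).im = 0) ∧
      X (2 * k - 1) = (Complex.normSq (X 0) : ℂ) +
        conj (X 0) * (((X 1).re : ℂ) + Complex.I * ((X 2).re : ℂ)) ∧
      (∀ σ : ℕ, 2 ≤ σ → σ ≤ k - 1 → X (2 * k - 2 + σ) = conj (X 0) *
        (((X (2 * σ - 1)).re : ℂ) + Complex.I * ((X (2 * σ)).re : ℂ))) ∧
      X (3 * k - 2) = conj (X 0) ^ 2 := by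
  rw [modelFun_eq_zero_iff]
  have hre : ∀ {i}, (X i).im = 0 → conj (X i) = X i ∧ ((X i).re : ℂ) = X i := fun {i} h =>
    ⟨Complex.conj_eq_iff_im.2 h, Complex.conj_eq_iff_re.1 (Complex.conj_eq_iff_im.2 h)⟩
  constructor
  · rintro ⟨h, hc⟩
    have hw : ∀ τ : ℕ, 1 ≤ τ → τ ≤ 2 * k - 2 → (X τ).im = 0 := fun i h1 h2 => by
      have := h (Sum.inl ⟨i - 1, by omega⟩)
      simp only [modelDefect, modelHol, modelAntihol, Sum.elim_inl,
        Nat.sub_add_cancel h1, sub_eq_zero] at this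
      exact Complex.conj_eq_iff_im.1 this.symm
    have ht : X (3 * k - 2) = conj (X 0) ^ 2 := by
      have := h (Sum.inr (Sum.inr 0))
      simp only [modelDefect, modelHol, modelAntihol, Sum.elim_inr, Matrix.cons_val,
        sub_eq_zero] at this
      rw [this, map_mul, sq]
    refine ⟨hw, ?_, fun σ h1 h2 => ?_, ht⟩
    · rw [(hre (hw 1 le_rfl (by omega))).2, (hre (hw 2 (by omega) (by omega))).2]
      by_cases hz : X 0 = 0
      · have := h (Sum.inr (Sum.inr 3))
        simpa [modelDefect, modelHol, modelAntihol, ht, hz] using this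
      · have := (mul_eq_zero.1 hc).resolve_left (mul_ne_zero hz hz)
        rw [sub_eq_zero] at this
        rw [this, Complex.normSq_eq_conj_mul_self, mul_add]
    · have := h (Sum.inr (Sum.inl ⟨σ - 2, by omega⟩))
      simp only [modelDefect, modelHol, modelAntihol, Sum.elim_inr, Sum.elim_inl, sub_eq_zero] at this
      rw [show 2 * k + (σ - 2) = 2 * k - 2 + σ by omega, show 2 * (σ - 2) + 3 = 2 * σ - 1 by omega,
        show 2 * (σ - 2) + 4 = 2 * σ by omega] at this
      rw [this, (hre (hw (2 * σ - 1) (by omega) (by omega))).2,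
        (hre (hw (2 * σ) (by omega) (by omega))).2]
      simp only [map_mul, map_sub, Complex.conj_I, (hre (hw (2 * σ - 1) (by omega) (by omega))).1,
        (hre (hw (2 * σ) (by omega) (by omega))).1]
      ring
  · rintro ⟨hw, hs, hζ, ht⟩
    have h1 := hre (hw 1 le_rfl (by omega))
    have h2 := hre (hw 2 (by omega) (by omega))
    rw [h1.2, h2.2, Complex.normSq_eq_conj_mul_self] at hs
    refine ⟨fun j => ?_, ?_⟩
    · rcases j with τ | σ | j
      · simp [modelDefect, modelHol, modelAntihol, (hre (hw (τ + 1) (by omega) (by omega))).1]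
      · have h3 := hre (hw (2 * σ + 3) (by omega) (by omega))
        have h4 := hre (hw (2 * σ + 4) (by omega) (by omega))
        have h5 := hζ (σ + 2) (by omega) (by omega)
        rw [show 2 * k - 2 + (σ + 2) = 2 * k + σ by omega,
          show 2 * ((σ : ℕ) + 2) - 1 = 2 * σ + 3 by omega,
          show 2 * ((σ : ℕ) + 2) = 2 * σ + 4 by omega, h3.2, h4.2] at h5
        simp only [modelDefect, modelHol, modelAntihol, Sum.elim_inr, Sum.elim_inl, h5, map_mul,
          map_sub, Complex.conj_I, h3.1, h4.1]
        ring
      · fin_cases j <;>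
          simp [modelDefect, modelHol, modelAntihol, ht, hs, h1.1, h2.1] <;> ring
    · rw [modelCubic, hs]
      ring

/-- The coordinates of a point of `ℂ^n`, extended by zero. -/
def coord {n : ℕ} (Z : EuclideanSpace ℂ (Fin n)) (i : ℕ) : ℂ := if h : i < n then Z ⟨i, h⟩ else 0

theorem modelFun_coord_eq_zero_iff (hk : 1 < k) (Z : EuclideanSpace ℂ (Fin (3 * k - 1))) :
    modelFun k (coord Z) = 0 ↔ Z ∈ bcForm k hk := by
  have hc : ∀ i (h : i < 3 * k - 1), Z ⟨i, h⟩ = coord Z i := fun i h => by simp [coord, h]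
  simp only [modelFun_eq_zero_iff_normalForm hk, bcForm, Set.mem_ofPred_eq, hc]

theorem contDiff_modelFun (k : ℕ) {E : Type*} [NormedAddCommGroup E] [NormedSpace ℝ E] {U : Set E}
    {x : ℕ → E → ℂ} (hx : ∀ i, ContDiffOn ℝ (⊤ : ℕ∞) (x i) U) :
    ContDiffOn ℝ (⊤ : ℕ∞) (fun y => modelFun k fun i => x i y) U := by
  have hconj : ∀ {g : E → ℂ}, ContDiffOn ℝ (⊤ : ℕ∞) g U →
      ContDiffOn ℝ (⊤ : ℕ∞) (fun y => conj (g y)) U := fun hg =>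
    Complex.conjCLE.contDiff.comp_contDiffOn hg
  have hsq : ∀ {g : E → ℂ}, ContDiffOn ℝ (⊤ : ℕ∞) g U →
      ContDiffOn ℝ (⊤ : ℕ∞) (fun y => Complex.normSq (g y)) U := fun hg => by
    simp only [Complex.normSq_apply]
    have h1 := Complex.reCLM.contDiff.comp_contDiffOn hg
    have h2 := Complex.imCLM.contDiff.comp_contDiffOn hg
    exact (h1.mul h1).add (h2.mul h2)
  have ha : ContDiffOn ℝ (⊤ : ℕ∞) (fun y => x 1 y + Complex.I * x 2 y) U :=
    (hx 1).add (contDiffOn_const.mul (hx 2))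
  have hb : ∀ i j, ContDiffOn ℝ (⊤ : ℕ∞) (fun y => x i y - Complex.I * x j y) U := fun i j =>
    (hx i).sub (contDiffOn_const.mul (hx j))
  have hhol : ∀ j, ContDiffOn ℝ (⊤ : ℕ∞) (fun y => modelHol k (fun i => x i y) j) U := by
    rintro (τ | σ | j)
    · exact hx _
    · exact hx _
    · fin_cases j
      · exact hx _
      · exact (hx _).add ((hx 0).mul (hb _ _))
      · exact ((hx 0).sub ha).mul (hx _)
      · exact ((hx _).mul (hx _)).sub ((hx _).mul (((hx 0).add ha).mul ((hx 0).add ha)))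
  have hanti : ∀ j, ContDiffOn ℝ (⊤ : ℕ∞) (fun y => modelAntihol k (fun i => x i y) j) U := by
    rintro (τ | σ | j)
    · exact hx _
    · exact (hx 0).mul (hb _ _)
    · fin_cases j
      · exact (hx 0).mul (hx 0)
      · exact (hx _).add ((hx 0).mul (hb _ _))
      · exact (hx 0).mul ((hx _).sub ((hb _ _).mul (hb _ _)))
      · exact contDiffOn_const
  refine ContDiffOn.add (ContDiffOn.sum fun j _ => ?_) (hsq ?_)
  · exact (contDiffOn_const.add (hsq (hx 0))).mul (hsq ((hhol j).sub (hconj (hanti j))))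
  · exact ((hx 0).mul (hx 0)).mul ((hx _).sub ((hconj (hx 0)).mul ((hx 0).add ha)))

/-- Near a generic CR-singularity `p`, the set `M` is the zero set of a smooth nonnegative
plurisubharmonic function that is strictly plurisubharmonic away from `p`. -/
theorem IsGenericCRSingularity.exists_psh {hk : 1 < k}
    {M : Set (EuclideanSpace ℂ (Fin (3 * k - 1)))} {p : EuclideanSpace ℂ (Fin (3 * k - 1))}
    (hp : IsGenericCRSingularity k hk M p) :
    ∃ (U : Set (EuclideanSpace ℂ (Fin (3 * k - 1)))) (r : EuclideanSpace ℂ (Fin (3 * k - 1)) → ℝ),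
      IsOpen U ∧ p ∈ U ∧ ContDiffOn ℝ (⊤ : ℕ∞) r U ∧ (∀ x ∈ U, 0 ≤ r x) ∧
      (∀ x ∈ U, r x = 0 ↔ x ∈ M) ∧ PshOn r U ∧ StrictPshOn r (U \ {p}) := by
  obtain ⟨U, V, Φ, Ψ, hU, hV, hpU, -, hΦ, hΨ, hUV, -, hΨΦ, -, hΦp, himg⟩ := hp
  have hΦc : ContDiffOn ℝ (⊤ : ℕ∞) Φ U :=
    (contDiffOn_infty_of_differentiableOn hΦ hU).restrict_scalars ℝ
  let W := U ∩ Φ ⁻¹' Metric.ball 0 (1 / 10)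
  have hW : IsOpen W := hΦ.continuousOn.isOpen_inter_preimage hU Metric.isOpen_ball
  let r : EuclideanSpace ℂ (Fin (3 * k - 1)) → ℝ := fun q => modelFun k (coord (Φ q))
  have hsmooth : ContDiffOn ℝ (⊤ : ℕ∞) r U := by
    refine contDiff_modelFun k fun i => ?_
    by_cases hi : i < 3 * k - 1
    · simp only [coord, hi, dif_pos]
      exact ((EuclideanSpace.proj (𝕜 := ℂ) (⟨i, hi⟩ : Fin (3 * k - 1))).restrictScalars
        ℝ).contDiff.comp_contDiffOn hΦc
    · simp only [coord, hi, dif_neg, not_false_eq_true]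
      exact contDiffOn_const
  have hlevi : ∀ q ∈ W, ∀ v, ∃ m, sliceLaplacian r q v = 4 * m ∧
      modelLevi k (coord (Φ q)) (coord (fderiv ℂ Φ q v)) / 4 ≤ m := by
    intro q hq v
    have hx : ∀ i, HasJet (fun t : ℂ => coord (Φ (q + t • v)) i) (coord (Φ q) i)
        (coord (fderiv ℂ Φ q v) i) 0 0 := by
      intro i
      by_cases hi : i < 3 * k - 1
      · simp only [coord, hi, dif_pos]
        have hc : Continuous fun t : ℂ => q + t • v := by fun_prop
        have h0 : q + (0 : ℂ) • v = q := by simp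
        have hev : ∀ᶠ t : ℂ in 𝓝 0, q + t • v ∈ U :=
          hc.continuousAt.eventually (hU.mem_nhds (by simpa using hq.1))
        have hder : ∀ t : ℂ, q + t • v ∈ U →
            HasDerivAt (fun t : ℂ => Φ (q + t • v) ⟨i, hi⟩)
              (fderiv ℂ Φ (q + t • v) v ⟨i, hi⟩) t := fun t ht => by
          have h1 := (hΦ.differentiableAt (hU.mem_nhds ht)).hasFDerivAt
          have h2 : HasDerivAt (fun t : ℂ => q + t • v) v t := by
            simpa using ((hasDerivAt_id t).smul_const v).const_add q
          exact (EuclideanSpace.proj (𝕜 := ℂ) (⟨i, hi⟩ : Fin (3 * k - 1))).hasFDerivAt.comp_hasDerivAt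
            t (h1.comp_hasDerivAt t h2)
        have := hasJet_of_differentiableAt (g := fun t : ℂ => Φ (q + t • v) ⟨i, hi⟩)
          (hev.mono fun t ht => (hder t ht).differentiableAt)
        rw [(hder 0 (by simpa using hq.1)).deriv, h0] at this
        exact this
      · simpa only [coord, hi, dif_neg, not_false_eq_true] using HasJet.const 0
    have hX : ∀ i, ‖coord (Φ q) i‖ ≤ 1 / 10 := by
      intro i
      by_cases hi : i < 3 * k - 1
      · simp only [coord, hi, dif_pos]
        exact (PiLp.norm_apply_le _ _).trans (mem_ball_zero_iff.1 hq.2).le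
      · simp [coord, hi]
    obtain ⟨a, b, c, d, hj, hd⟩ := exists_hasJet_modelFun hk hx hX
    exact ⟨d.re, HasJet.sliceLaplacian_eq hj, hd⟩
  have hcoord : ∀ Z : EuclideanSpace ℂ (Fin (3 * k - 1)),
      (∀ i < 3 * k - 1, coord Z i = 0) → Z = 0 := fun Z hZ => by
    ext i
    simpa [coord] using hZ i i.2
  refine ⟨W, r, hW, ⟨hpU, by simp [hΦp]⟩, hsmooth.mono Set.inter_subset_left,
    fun x _ => modelFun_nonneg _ _, fun x hx => ?_, fun q hq v => ?_, fun q hq v hv => ?_⟩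
  · rw [modelFun_coord_eq_zero_iff hk]
    constructor
    · intro h
      obtain ⟨y, hy, hyx⟩ : Φ x ∈ Φ '' (M ∩ U) := himg ▸ ⟨h, hUV hx.1⟩
      rw [← hΨΦ x hx.1, ← hyx, hΨΦ y hy.2]
      exact hy.1
    · intro h
      have : Φ x ∈ bcForm k hk ∩ V := himg ▸ Set.mem_image_of_mem Φ ⟨h, hx.1⟩
      exact this.1
  · obtain ⟨m, h1, h2⟩ := hlevi q hq v
    linarith [modelLevi_nonneg k (coord (Φ q)) (coord (fderiv ℂ Φ q v))]
  · obtain ⟨m, h1, h2⟩ := hlevi q hq.1 v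
    by_contra! hle
    have h0 : modelLevi k (coord (Φ q)) (coord (fderiv ℂ Φ q v)) = 0 :=
      le_antisymm (by linarith) (modelLevi_nonneg _ _ _)
    rcases eq_zero_or_eq_zero_of_modelLevi_eq_zero hk h0 with h | h
    · have hd : fderiv ℂ Φ q v = 0 := hcoord _ h
      have h1 : HasFDerivAt Φ (fderiv ℂ Φ q) q :=
        (hΦ.differentiableAt (hU.mem_nhds hq.1.1)).hasFDerivAt
      have h2 : HasFDerivAt Ψ (fderiv ℂ Ψ (Φ q)) (Φ q) :=
        (hΨ.differentiableAt (hV.mem_nhds (hUV hq.1.1))).hasFDerivAt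
      have h3 : HasFDerivAt id ((fderiv ℂ Ψ (Φ q)).comp (fderiv ℂ Φ q)) q := by
        refine (h2.comp q h1).congr_of_eventuallyEq ?_
        filter_upwards [hU.mem_nhds hq.1.1] with x hx using (hΨΦ x hx).symm
      have h4 := DFunLike.congr_fun (h3.unique (hasFDerivAt_id q)) v
      apply hv
      simpa [hd] using h4.symm
    · have hq0 : Φ q = 0 := hcoord _ h
      refine hq.2 ?_
      rw [Set.mem_singleton_iff, ← hΨΦ q hq.1.1, hq0, ← hΦp, hΨΦ p hpU]

end Model

section Gluing

open Filter Topology Set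

variable {n : ℕ}

theorem sliceLaplacian_congr {ρ r : EuclideanSpace ℂ (Fin n) → ℝ} {p : EuclideanSpace ℂ (Fin n)}
    (h : ρ =ᶠ[𝓝 p] r) (v : EuclideanSpace ℂ (Fin n)) :
    sliceLaplacian ρ p v = sliceLaplacian r p v := by
  have hc : Tendsto (fun t : ℂ => p + t • v) (𝓝 0) (𝓝 p) := by
    have : Continuous fun t : ℂ => p + t • v := by fun_prop
    simpa using this.tendsto 0
  have h2 : (fun t : ℂ => ρ (p + t • v)) =ᶠ[𝓝 0] fun t => r (p + t • v) := hc.eventually h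
  simp only [sliceLaplacian, (h2.iteratedFDeriv ℝ 2).eq_of_nhds]

theorem StrictPshAt.sliceLaplacian_nonneg {ρ : EuclideanSpace ℂ (Fin n) → ℝ}
    {p : EuclideanSpace ℂ (Fin n)} (h : StrictPshAt ρ p) (v : EuclideanSpace ℂ (Fin n)) :
    0 ≤ sliceLaplacian ρ p v := by
  by_cases hv : v = 0
  · subst hv
    rw [HasJet.sliceLaplacian_eq (by simpa using HasJet.const (ρ p))]
    simp
  · exact (h v hv).le

/-- Multiplication by a cutoff function at a minimum with value zero scales the Levi form. -/
theorem exists_hasJet_slice_mul {χ r : EuclideanSpace ℂ (Fin n) → ℝ}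
    {q : EuclideanSpace ℂ (Fin n)} (hχ : ContDiffAt ℝ 2 χ q) (hr : ContDiffAt ℝ 2 r q)
    (h0 : r q = 0) (hmin : IsLocalMin r q) (v : EuclideanSpace ℂ (Fin n)) :
    ∃ a b c d, HasJet (fun t : ℂ => ((χ (q + t • v) * r (q + t • v) : ℝ) : ℂ)) a b c d ∧
      4 * d.re = χ q * sliceLaplacian r q v := by
  obtain ⟨b, c, d, hj, -, -⟩ := hχ.exists_hasJet_slice v
  obtain ⟨b', c', d', hj', hL, hz⟩ := hr.exists_hasJet_slice v
  obtain ⟨rfl, rfl⟩ := hz hmin.fderiv_eq_zero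
  refine ⟨_, _, _, _, by simpa only [Complex.ofReal_mul] using hj.mul hj', ?_⟩
  simp [h0, hL]
  ring

/-- Local defining functions that are strictly plurisubharmonic off `S` can be glued. -/
theorem exists_psh_of_forall_exists_psh {M S : Set (EuclideanSpace ℂ (Fin n))} (hM : IsClosed M)
    (h : ∀ p ∈ M, ∃ (U : Set (EuclideanSpace ℂ (Fin n))) (r : EuclideanSpace ℂ (Fin n) → ℝ),
      IsOpen U ∧ p ∈ U ∧ U ∩ S ⊆ {p} ∧ ContDiffOn ℝ (⊤ : ℕ∞) r U ∧ (∀ x ∈ U, 0 ≤ r x) ∧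
      (∀ x ∈ U, r x = 0 ↔ x ∈ M) ∧ PshOn r U ∧ StrictPshOn r (U \ S)) :
    ∃ (U : Set (EuclideanSpace ℂ (Fin n))) (ρ : EuclideanSpace ℂ (Fin n) → ℝ),
      IsOpen U ∧ M ⊆ U ∧ ContDiffOn ℝ (⊤ : ℕ∞) ρ U ∧ (∀ x ∈ U, 0 ≤ ρ x) ∧
      {x ∈ U | ρ x = 0} = M ∧ PshOn ρ U ∧ StrictPshOn ρ (U \ S) := by
  choose! V f hVo hpV hVS hfc hfnn hf0 hfpsh hfstrict using h
  let U : Option M → Set (EuclideanSpace ℂ (Fin n)) := fun i => i.elim Mᶜ fun p => V p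
  let r : Option M → EuclideanSpace ℂ (Fin n) → ℝ := fun i => i.elim 1 fun p => f p
  have hUo : ∀ i, IsOpen (U i) := by
    rintro (_ | p)
    · exact hM.isOpen_compl
    · exact hVo p p.2
  have hrc : ∀ i, ContDiffOn ℝ (⊤ : ℕ∞) (r i) (U i) := by
    rintro (_ | p)
    · exact contDiffOn_const
    · exact hfc p p.2
  have hrnn : ∀ i, ∀ x ∈ U i, 0 ≤ r i x := by
    rintro (_ | p) x hx
    · exact zero_le_one
    · exact hfnn p p.2 x hx
  have hr0 : ∀ i, ∀ x ∈ U i, r i x = 0 ↔ x ∈ M := by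
    rintro (_ | p) x hx
    · exact iff_of_false one_ne_zero hx
    · exact hf0 p p.2 x hx
  have hcover : univ ⊆ ⋃ i, U i := fun x _ => by
    by_cases hx : x ∈ M
    · exact mem_iUnion.2 ⟨some ⟨x, hx⟩, hpV x hx⟩
    · exact mem_iUnion.2 ⟨none, hx⟩
  obtain ⟨χ, hχ⟩ := SmoothPartitionOfUnity.exists_isSubordinate
    (𝓘(ℝ, EuclideanSpace ℂ (Fin n))) isClosed_univ U hUo hcover
  have hχU : ∀ i x, x ∉ U i → ∀ᶠ y in 𝓝 x, χ i y = 0 := fun i x hx =>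
    notMem_tsupport_iff_eventuallyEq.1 fun hx' => hx (hχ i hx')
  have hχU' : ∀ i x, χ i x ≠ 0 → x ∈ U i := fun i x hx => by
    by_contra hxU
    exact hx (hχU i x hxU).self_of_nhds
  have hχc : ∀ i, ContDiff ℝ (⊤ : ℕ∞) (χ i) := fun i => (χ i).contMDiff.contDiff
  let ρ : EuclideanSpace ℂ (Fin n) → ℝ := fun x => ∑ᶠ i, χ i x • r i x
  have hρc : ContDiff ℝ (⊤ : ℕ∞) ρ :=
    (hχ.contMDiff_finsum_smul hUo fun i => (hrc i).contMDiffOn).contDiff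
  have hterm : ∀ i x, 0 ≤ χ i x * r i x := fun i x => by
    by_cases hx : χ i x = 0
    · simp [hx]
    · exact mul_nonneg (χ.nonneg i x) (hrnn i x (hχU' i x hx))
  have hlocal : ∀ q, ∃ I : Finset (Option M), ∀ᶠ x in 𝓝 q, ∑ i ∈ I, χ i x = 1 ∧
      ρ x = ∑ i ∈ I, χ i x * r i x := fun q => by
    obtain ⟨I, hI⟩ := χ.toPartitionOfUnity.exists_finset_nhds q
    refine ⟨I, hI.mono fun x hx => ⟨hx.1, ?_⟩⟩
    refine finsum_eq_sum_of_support_subset _ fun i hi => hx.2 ?_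
    rw [Function.mem_support] at hi ⊢
    exact (smul_ne_zero_iff.1 hi).1
  have hρ0 : ∀ x, ρ x = 0 ↔ x ∈ M := by
    intro x
    obtain ⟨I, hI⟩ := hlocal x
    obtain ⟨h1, h2⟩ := hI.self_of_nhds
    rw [h2, Finset.sum_eq_zero_iff_of_nonneg fun i _ => hterm i x]
    constructor
    · intro h
      obtain ⟨i, hi, hne⟩ := Finset.exists_ne_zero_of_sum_ne_zero (h1.trans_ne one_ne_zero)
      exact (hr0 i x (hχU' i x hne)).1 ((mul_eq_zero.1 (h i hi)).resolve_left hne)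
    · intro hx i _
      by_cases hne : χ i x = 0
      · simp [hne]
      · simp [(hr0 i x (hχU' i x hne)).2 hx]
  have hstrict : ∀ q ∈ M \ S, StrictPshAt ρ q := by
    rintro q ⟨hqM, hqS⟩ v hv
    obtain ⟨I, hI⟩ := hlocal q
    have hjet : ∀ i, ∃ a b c d,
        HasJet (fun t : ℂ => ((χ i (q + t • v) * r i (q + t • v) : ℝ) : ℂ)) a b c d ∧
          0 ≤ d.re ∧ (χ i q ≠ 0 → 0 < d.re) := by
      intro i
      by_cases hqU : q ∈ U i
      · have hnhds := (hUo i).mem_nhds hqU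
        have hLpos : 0 < sliceLaplacian (r i) q v := by
          rcases i with _ | p
          · exact absurd hqM hqU
          · exact hfstrict p p.2 q ⟨hqU, hqS⟩ v hv
        have hrq : r i q = 0 := (hr0 i q hqU).2 hqM
        obtain ⟨a, b, c, d, hj, hd⟩ := exists_hasJet_slice_mul
          ((hχc i).contDiffAt.of_le two_le_infty) (((hrc i).contDiffAt hnhds).of_le two_le_infty)
          hrq (by
            filter_upwards [hnhds] with x hx
            rw [hrq]
            exact hrnn i x hx) v
        refine ⟨a, b, c, d, hj, ?_, fun hne => ?_⟩
        · have := mul_nonneg (χ.nonneg i q) hLpos.le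
          linarith
        · have := mul_pos ((χ.nonneg i q).lt_of_ne' hne) hLpos
          linarith
      · have hc : Tendsto (fun t : ℂ => q + t • v) (𝓝 0) (𝓝 q) := by
          have : Continuous fun t : ℂ => q + t • v := by fun_prop
          simpa using this.tendsto 0
        refine ⟨0, 0, 0, 0, (HasJet.const 0).congr ?_, le_rfl, fun hne =>
          absurd (hχU i q hqU).self_of_nhds hne⟩
        filter_upwards [hc.eventually (hχU i q hqU)] with t ht
        simp [ht]
    choose a b c d hj hd hd' using hjet
    have hc : Tendsto (fun t : ℂ => q + t • v) (𝓝 0) (𝓝 q) := by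
      have : Continuous fun t : ℂ => q + t • v := by fun_prop
      simpa using this.tendsto 0
    have hsum : HasJet (fun t : ℂ => (ρ (q + t • v) : ℂ)) _ _ _ _ :=
      (HasJet.sum (s := I) fun i _ => hj i).congr (by
        filter_upwards [hc.eventually hI] with t ht
        rw [ht.2, Complex.ofReal_sum])
    rw [hsum.sliceLaplacian_eq, Complex.re_sum]
    obtain ⟨i, hi, hne⟩ :=
      Finset.exists_ne_zero_of_sum_ne_zero (hI.self_of_nhds.1.trans_ne one_ne_zero)
    exact mul_pos four_pos (Finset.sum_pos' (fun i _ => hd i) ⟨i, hi, hd' i hne⟩)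
  have hMU : ∀ q ∈ M, ∀ᶠ y in 𝓝 q,
      (∀ v, 0 ≤ sliceLaplacian ρ y v) ∧ (y ∉ S → StrictPshAt ρ y) := by
    intro q hq
    by_cases hqS : q ∈ S
    · have hother : ∀ i, i ≠ some ⟨q, hq⟩ → q ∉ U i := by
        rintro (_ | p) hi hqU
        · exact hqU hq
        · exact hi (congrArg some (Subtype.ext (hVS p p.2 ⟨hqU, hqS⟩).symm))
      obtain ⟨I, hI⟩ := hlocal q
      have hzero : ∀ᶠ y in 𝓝 q, ∀ i ∈ I, i ≠ some ⟨q, hq⟩ → χ i y = 0 :=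
        (eventually_all_finset I).2 fun i _ => by
          by_cases hi : i = some ⟨q, hq⟩
          · exact Eventually.of_forall fun _ h => absurd hi h
          · exact (hχU i q (hother i hi)).mono fun _ h _ => h
      have heq : ∀ᶠ y in 𝓝 q, ρ y = f q y := by
        filter_upwards [hI, hzero] with y hy hy0
        have hmem : some ⟨q, hq⟩ ∈ I := by
          obtain ⟨i, hi, hne⟩ := Finset.exists_ne_zero_of_sum_ne_zero (hy.1.trans_ne one_ne_zero)
          by_cases hiq : i = some ⟨q, hq⟩
          · exact hiq ▸ hi
          · exact absurd (hy0 i hi hiq) hne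
        have h1 : χ (some ⟨q, hq⟩) y = 1 := by
          rw [← hy.1, Finset.sum_eq_single_of_mem _ hmem hy0]
        rw [hy.2, Finset.sum_eq_single_of_mem _ hmem fun i hi hiq => by simp [hy0 i hi hiq], h1,
          one_mul]
        rfl
      filter_upwards [heq.eventually_nhds, (hVo q hq).mem_nhds (hpV q hq)] with y hy hyV
      refine ⟨fun v => ?_, fun hyS v hv => ?_⟩
      · rw [sliceLaplacian_congr hy]
        exact hfpsh q hq y hyV v
      · rw [sliceLaplacian_congr hy]
        exact hfstrict q hq y ⟨hyV, hyS⟩ v hv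
    · exact ((hstrict q ⟨hq, hqS⟩).eventually (hρc.contDiffAt.of_le two_le_infty)).mono
        fun y hy => ⟨hy.sliceLaplacian_nonneg, fun _ => hy⟩
  refine ⟨{x | ∀ᶠ y in 𝓝 x, (∀ v, 0 ≤ sliceLaplacian ρ y v) ∧ (y ∉ S → StrictPshAt ρ y)}, ρ,
    isOpen_setOfPred_eventually_nhds, hMU, hρc.contDiffOn,
    fun x _ => finsum_nonneg fun i => hterm i x,
    ext fun x => ⟨fun hx => (hρ0 x).1 hx.2, fun hx => ⟨hMU x hx, (hρ0 x).2 hx⟩⟩,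
    fun x hx => hx.self_of_nhds.1, fun x hx => hx.1.self_of_nhds.2 hx.2⟩

end Gluing

/-- **Theorem 1.4 (1).** Let `M ⊆ ℂ^{3k-1}` (`k > 1`) be a `2k`-dimensional smooth compact
connected submanifold that is totally real except on a finite set `S` of generic
CR-singularities. Then `M = ρ⁻¹(0)` for a smooth nonnegative function `ρ` on some
neighbourhood `U` of `M` that is p.s.h. on `U` and strictly p.s.h. on `U \ S`. -/
theorem psh_defining_function_local
    (k : ℕ) (hk : 1 < k)
    (M S : Set (EuclideanSpace ℂ (Fin (3*k-1))))
    (hsub : IsSubmanifold (2*k) (by omega) M)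
    (hcpt : IsCompact M) (hconn : IsConnected M)
    (hS : S.Finite) (hSM : S ⊆ M)
    (htr : ∀ p ∈ M \ S, TotallyRealAt M p)
    (hcr : ∀ p ∈ S, IsGenericCRSingularity k hk M p) :
    ∃ (U : Set (EuclideanSpace ℂ (Fin (3*k-1)))) (ρ : EuclideanSpace ℂ (Fin (3*k-1)) → ℝ),
      IsOpen U ∧ M ⊆ U ∧ ContDiffOn ℝ (⊤ : ℕ∞) ρ U ∧ (∀ x ∈ U, 0 ≤ ρ x) ∧
      {x ∈ U | ρ x = 0} = M ∧ PshOn ρ U ∧ StrictPshOn ρ (U \ S) := by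
  refine exists_psh_of_forall_exists_psh hcpt.isClosed fun p hp => ?_
  by_cases hpS : p ∈ S
  · obtain ⟨U, r, hU, hpU, hr, hnn, h0, hpsh, hstrict⟩ := (hcr p hpS).exists_psh
    refine ⟨U \ (S \ {p}), r, hU.sdiff (hS.subset Set.sdiff_subset).isClosed,
      ⟨hpU, fun h => h.2 rfl⟩, fun x hx => ?_, hr.mono Set.sdiff_subset, fun x hx => hnn x hx.1,
      fun x hx => h0 x hx.1, fun x hx => hpsh x hx.1,
      fun x hx => hstrict x ⟨hx.1.1, fun hxp => hx.2 ?_⟩⟩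
    · by_contra hxp
      exact hx.1.2 ⟨hx.2, hxp⟩
    · rwa [Set.mem_singleton_iff.1 hxp]
  · obtain ⟨U, r, hU, hpU, hr, hnn, h0, hstrict⟩ :=
      exists_strictPsh_of_totallyRealAt hsub hcpt.isClosed hp (htr p ⟨hp, hpS⟩)
    exact ⟨U \ S, r, hU.sdiff hS.isClosed, ⟨hpU, hpS⟩, fun x hx => absurd hx.2 hx.1.2,
      hr.mono Set.sdiff_subset, fun x hx => hnn x hx.1, fun x hx => h0 x hx.1,
      fun x hx => (hstrict x hx.1).sliceLaplacian_nonneg, fun x hx => hstrict x hx.1.1⟩
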